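/- Let 𝐏⃗ be a finite collection of multi-tiles of rank 1, fix 1 ≤ i ≤ n, let aᵢ, λᵢ > 0, and suppose fᵢ satisfies ‖fᵢ·χ̃_I^N‖_{L¹} ≤ aᵢλᵢ|I| for every bounded interval I. Then size_i(T) ≤ C·aᵢλᵢ for every tree T in 𝐏⃗, with C depending only on n, N and the fixed tile constants. -/

import Mathlib

open MeasureTheory Real Complex
open scoped FourierTransform ENNReal NNReal Classical
noncomputable section

structure Iv where
  l : ℝ
  len : ℝ

def Iv.set (I : Iv) : Set ℝ := Set.Ioo I.l (I.l + I.len)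

def Iv.dil (c : ℝ) (I : Iv) : Set ℝ :=
  Set.Ioo (I.l + I.len / 2 - c * I.len / 2) (I.l + I.len / 2 + c * I.len / 2)

def Iv.chi (I : Iv) (x : ℝ) : ℝ := (1 + Metric.infDist x I.set / I.len)⁻¹

structure Tile where
  j : ℤ
  kt : ℤ
  kf : ℤ

def Tile.timeIv (P : Tile) : Iv := ⟨(2:ℝ)^P.j * P.kt, (2:ℝ)^P.j⟩

def Tile.freqIv (β : ℝ) (P : Tile) : Iv :=
  ⟨(2:ℝ)^(-P.j) * ((P.kf : ℝ) + (-1:ℝ)^(-P.j) * β), (2:ℝ)^(-P.j)⟩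

def Tile.lt' (β : ℝ) (P' P : Tile) : Prop :=
  (P'.timeIv).set ⊂ (P.timeIv).set ∧ (P.freqIv β).set ⊆ (P'.freqIv β).dil 3

def Tile.le' (β : ℝ) (P' P : Tile) : Prop := Tile.lt' β P' P ∨ P' = P

def Tile.lesim (β c : ℝ) (P' P : Tile) : Prop :=
  (P'.timeIv).set ⊆ (P.timeIv).set ∧ (P.freqIv β).set ⊆ (P'.freqIv β).dil c

def Tile.lesim' (β c : ℝ) (P' P : Tile) : Prop :=
  Tile.lesim β c P' P ∧ ¬ Tile.le' β P' P

structure MultiTile (n : ℕ) where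
  j : ℤ
  kt : ℤ
  kf : Fin n → ℤ

def MultiTile.tile {n : ℕ} (P : MultiTile n) (i : Fin n) : Tile := ⟨P.j, P.kt, P.kf i⟩

def MultiTile.timeIv {n : ℕ} (P : MultiTile n) : Iv := ⟨(2:ℝ)^P.j * P.kt, (2:ℝ)^P.j⟩

def MultiTile.freqCube {n : ℕ} (α : Fin n → ℝ) (P : MultiTile n) : Set (Fin n → ℝ) :=
  {ξ | ∀ i, ξ i ∈ ((P.tile i).freqIv (α i)).set}

def HasRank (n k : ℕ) (α : Fin n → ℝ) (c₃ csmall : ℝ) (Ps : Finset (MultiTile n)) : Prop :=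
  ∀ P ∈ Ps, ∀ P' ∈ Ps, ∀ ι : Fin k → Fin n, StrictMono ι →
    (∀ s, Tile.le' (α (ι s)) (MultiTile.tile P' (ι s)) (MultiTile.tile P (ι s))) →
    (∀ i, Tile.lesim (α i) c₃ (MultiTile.tile P' i) (MultiTile.tile P i)) ∧
    ((2:ℝ)^P'.j ≤ csmall * (2:ℝ)^P.j →
      ∃ i i' : Fin n, i ≠ i' ∧ Tile.lesim' (α i) c₃ (MultiTile.tile P' i) (MultiTile.tile P i) ∧
        Tile.lesim' (α i') c₃ (MultiTile.tile P' i') (MultiTile.tile P i'))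

def AdaptedBump (w : Iv) (Ca : ℕ → ℝ) (M : ℕ) (ψ : ℝ → ℂ) : Prop :=
  ContDiff ℝ (⊤ : ℕ∞) ψ ∧ (∀ ξ, ξ ∉ w.set → ψ ξ = 0) ∧ (∀ ξ ∈ w.dil (9/10), ψ ξ = 1) ∧
  ∀ a : ℕ, a ≤ M → ∀ ξ : ℝ, ‖iteratedDeriv a ψ ξ‖ ≤ Ca a / w.len ^ a

def mulOp (ψ : ℝ → ℂ) (f : ℝ → ℂ) (x : ℝ) : ℂ :=
  ∫ ξ : ℝ, ψ ξ * 𝓕 f ξ * Complex.exp (2 * Real.pi * Complex.I * ξ * x)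

def tileNorm (N : ℕ) (ψ : ℝ → ℂ) (P : Tile) (f : ℝ → ℂ) : ℝ :=
  ((2:ℝ)^P.j)⁻¹ * ∫ x : ℝ, ‖mulOp ψ f x‖ * (P.timeIv).chi x ^ (2*N)

def IsTree (n : ℕ) (α : Fin n → ℝ) (Ps T : Finset (MultiTile n)) (PT : MultiTile n)
    (jdx : Fin n) : Prop :=
  PT ∈ Ps ∧ T ⊆ Ps ∧ ∀ P ∈ T, Tile.le' (α jdx) (MultiTile.tile P jdx) (MultiTile.tile PT jdx)

def treeNorm (n N : ℕ) (ψ : Fin n → Tile → ℝ → ℂ) (i : Fin n) (f : ℝ → ℂ)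
    (T : Finset (MultiTile n)) : ℝ :=
  ⨆ P ∈ T, tileNorm N (ψ i (MultiTile.tile P i)) (MultiTile.tile P i) f

def treeSize (n N : ℕ) (α : Fin n → ℝ) (c₃ : ℝ) (ψ : Fin n → Tile → ℝ → ℂ)
    (i : Fin n) (f : ℝ → ℂ) (T : Finset (MultiTile n)) (PT : MultiTile n) : ℝ :=
  Real.sqrt (((2:ℝ)^PT.j)⁻¹ * ∑ P ∈ T,
      if Tile.lesim' (α i) c₃ (MultiTile.tile P i) (MultiTile.tile PT i)
      then (2:ℝ)^P.j * tileNorm N (ψ i (MultiTile.tile P i)) (MultiTile.tile P i) f ^ 2 else 0)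
    + treeNorm n N ψ i f T

def StronglyDisjoint (n : ℕ) (α : Fin n → ℝ) (i : Fin n)
    (T : Finset (MultiTile n)) (PT : MultiTile n)
    (T' : Finset (MultiTile n)) (PT' : MultiTile n) : Prop :=
  (∀ P ∈ T, ∀ P' ∈ T', MultiTile.tile P i ≠ MultiTile.tile P' i) ∧
  (∀ P ∈ T, ∀ P' ∈ T',
    ((MultiTile.tile P i).freqIv (α i)).set ⊂ ((MultiTile.tile P' i).freqIv (α i)).set →
    (MultiTile.timeIv P').set ∩ (MultiTile.timeIv PT).set = ∅) ∧
  (∀ P ∈ T, ∀ P' ∈ T',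
    ((MultiTile.tile P' i).freqIv (α i)).set ⊂ ((MultiTile.tile P i).freqIv (α i)).set →
    (MultiTile.timeIv P).set ∩ (MultiTile.timeIv PT').set = ∅)

def setDist {E : Type*} [PseudoMetricSpace E] (s t : Set E) : ℝ :=
  ⨅ x ∈ s, Metric.infDist x t

lemma flip_fourier {f g : ℝ → ℂ} (hf : Integrable f) (hg : Integrable g) :
    ∫ ξ, 𝓕 f ξ * g ξ = ∫ x, f x * 𝓕 g x := by
  have := VectorFourier.integral_fourierIntegral_smul_eq_flip (μ := volume) (ν := volume)
    (L := innerₗ ℝ) Real.continuous_fourierChar continuous_inner hf hg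
  simp only [flip_innerₗ, smul_eq_mul] at this
  exact this

lemma cont_fourier {f : ℝ → ℂ} (hf : Integrable f) : Continuous (𝓕 f) :=
  VectorFourier.fourierIntegral_continuous Real.continuous_fourierChar
    continuous_inner hf

lemma cont_fourierInv {f : ℝ → ℂ} (hf : Integrable f) : Continuous (𝓕⁻ f) := by
  have : 𝓕⁻ f = fun w => 𝓕 f (-w) := by ext w; exact fourierInv_eq_fourier_neg f w
  rw [this]
  exact (cont_fourier hf).comp continuous_neg

lemma norm_fourier_le {f : ℝ → ℂ} (w : ℝ) : ‖𝓕 f w‖ ≤ ∫ x, ‖f x‖ :=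
  VectorFourier.norm_fourierIntegral_le_integral_norm _ _ _ _ _

lemma norm_fourierInv_le {f : ℝ → ℂ} (w : ℝ) : ‖𝓕⁻ f w‖ ≤ ∫ x, ‖f x‖ := by
  rw [fourierInv_eq_fourier_neg]; exact norm_fourier_le _

lemma plancherel_ae {f : ℝ → ℂ} (hf : Integrable f) (h2 : MemLp f 2) :
    ((𝓕 (h2.toLp f) : Lp ℂ 2 (volume : Measure ℝ)) : ℝ → ℂ) =ᵐ[volume] 𝓕 f := by
  refine ae_eq_of_integral_contDiff_smul_eq ?_ (cont_fourier hf).locallyIntegrable ?_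
  · exact (Lp.memLp _).locallyIntegrable (by norm_num)
  · intro g hg hgc
    have hgc' : HasCompactSupport (fun x => (g x : ℂ)) := hgc.comp_left (g := fun t : ℝ => (t : ℂ)) (by simp)
    have hg' : ContDiff ℝ (⊤ : ℕ∞) (fun x => (g x : ℂ)) := Complex.ofRealCLM.contDiff.comp hg
    set G : SchwartzMap ℝ ℂ := hgc'.toSchwartzMap hg' with hG
    have hGx : ∀ x, G x = (g x : ℂ) := fun x => rfl
    have h1 := congrArg (fun t : TemperedDistribution ℝ ℂ => t G) (MeasureTheory.Lp.fourier_toTemperedDistribution_eq (h2.toLp f))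
    simp only [TemperedDistribution.fourier_apply, Lp.toTemperedDistribution_apply] at h1
    have h3 : ∫ x, (𝓕 G : SchwartzMap ℝ ℂ) x • (h2.toLp f) x = ∫ x, f x * 𝓕 (G : ℝ → ℂ) x := by
      apply integral_congr_ae
      filter_upwards [h2.coeFn_toLp] with x hx
      rw [hx, SchwartzMap.fourier_coe, smul_eq_mul, mul_comm]
    rw [h3, ← flip_fourier hf G.integrable] at h1
    simp only [hGx, smul_eq_mul] at h1
    simp only [Complex.real_smul]
    rw [← h1]
    congr 1; ext x; rw [mul_comm]

lemma plancherel_memLp {f : ℝ → ℂ} (hf : Integrable f) (h2 : MemLp f 2) : MemLp (𝓕 f) 2 :=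
  (memLp_congr_ae (plancherel_ae hf h2)).1 (Lp.memLp _)

lemma plancherel_norm {f : ℝ → ℂ} (hf : Integrable f) (h2 : MemLp f 2) :
    ‖(plancherel_memLp hf h2).toLp (𝓕 f)‖ = ‖h2.toLp f‖ := by
  rw [← MeasureTheory.Lp.norm_fourier_eq (h2.toLp f)]
  congr 1
  apply Lp.ext
  exact (MemLp.coeFn_toLp _).trans (plancherel_ae hf h2).symm

lemma mulOp_eq (φ F : ℝ → ℂ) (x : ℝ) : mulOp φ F x = 𝓕⁻ (fun ξ => φ ξ * 𝓕 F ξ) x := by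
  rw [mulOp, fourierInv_eq']
  congr 1; ext ξ
  simp only [smul_eq_mul]
  rw [mul_comm]
  congr 2
  simp
  ring

lemma int_mul_fourier {φ F : ℝ → ℂ} (hφ : Integrable φ) (hF : Integrable F) :
    Integrable (fun ξ => φ ξ * 𝓕 F ξ) := by
  refine hφ.mul_bdd (c := ∫ x, ‖F x‖) (cont_fourier hF).aestronglyMeasurable ?_
  exact Filter.Eventually.of_forall fun w => norm_fourier_le w

lemma int_mul_fourierInv {φ F : ℝ → ℂ} (hφ : Integrable φ) (hF : Integrable F) :
    Integrable (fun ξ => φ ξ * 𝓕⁻ F ξ) := by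
  refine hφ.mul_bdd (c := ∫ x, ‖F x‖) (cont_fourierInv hF).aestronglyMeasurable ?_
  exact Filter.Eventually.of_forall fun w => norm_fourierInv_le w

lemma mulOp_cont {φ F : ℝ → ℂ} (hφ : Integrable φ) (hF : Integrable F) :
    Continuous (mulOp φ F) := by
  have : mulOp φ F = 𝓕⁻ (fun ξ => φ ξ * 𝓕 F ξ) := by ext x; exact mulOp_eq _ _ _
  rw [this]; exact cont_fourierInv (int_mul_fourier hφ hF)

lemma fourierInv_shift (φ : ℝ → ℂ) (x y : ℝ) :
    𝓕 (fun ξ => φ ξ * Complex.exp (2 * Real.pi * Complex.I * ξ * x)) y = 𝓕⁻ φ (x - y) := by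
  rw [Real.fourier_eq', fourierInv_eq']
  congr 1; ext ξ
  simp only [smul_eq_mul]
  rw [mul_comm (φ ξ), ← mul_assoc, ← Complex.exp_add]
  congr 2
  simp
  ring

lemma int_mul_exp {φ : ℝ → ℂ} (hφ : Integrable φ) (x : ℝ) :
    Integrable (fun ξ : ℝ => φ ξ * Complex.exp (2 * Real.pi * Complex.I * ξ * x)) := by
  refine hφ.mul_bdd (c := 1) (by fun_prop) ?_
  refine Filter.Eventually.of_forall fun w => le_of_eq ?_
  rw [show (2 * Real.pi * Complex.I * w * x : ℂ) = ((2 * Real.pi * w * x : ℝ) : ℂ) * Complex.I by push_cast; ring]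
  exact Complex.norm_exp_ofReal_mul_I _

lemma mulOp_conv {φ F : ℝ → ℂ} (hφ : Integrable φ) (hF : Integrable F) (x : ℝ) :
    mulOp φ F x = ∫ y, F y * 𝓕⁻ φ (x - y) := by
  have := flip_fourier hF (int_mul_exp hφ x)
  simp only [fourierInv_shift] at this
  rw [← this, mulOp]
  congr 1; ext ξ; ring

/-- pairing -/
lemma mulOp_pair {φ F h : ℝ → ℂ} (hφ : Integrable φ) (hF : Integrable F) (hh : Integrable h) :
    ∫ x, mulOp φ F x * h x = ∫ ξ, φ ξ * 𝓕 F ξ * 𝓕⁻ h ξ := by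
  have h1 := flip_fourier (f := fun ξ => φ (-ξ) * 𝓕 F (-ξ)) (g := h)
    (int_mul_fourier hφ hF).comp_neg hh
  have h2 : 𝓕 (fun ξ => φ (-ξ) * 𝓕 F (-ξ)) = mulOp φ F := by
    rw [← fourierInv_eq_fourier_comp_neg (fun ξ => φ ξ * 𝓕 F ξ)]
    ext x; rw [mulOp_eq]
  rw [h2] at h1
  rw [h1, ← integral_neg_eq_self]
  simp only [neg_neg, fourierInv_eq_fourier_neg]

lemma mulOp_add {φ F G : ℝ → ℂ} (hφ : Integrable φ) (hF : Integrable F) (hG : Integrable G) (x : ℝ) :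
    mulOp φ (fun y => F y + G y) x = mulOp φ F x + mulOp φ G x := by
  have hb : ∀ H : ℝ → ℂ, Integrable H → Integrable (fun y => H y * 𝓕⁻ φ (x - y)) := by
    intro H hH
    refine hH.mul_bdd (c := ∫ x, ‖φ x‖) ?_ ?_
    · exact ((cont_fourierInv hφ).comp (by fun_prop)).aestronglyMeasurable
    · exact Filter.Eventually.of_forall fun w => norm_fourierInv_le _
  rw [mulOp_conv hφ (F := fun y => F y + G y) (hF.add hG), mulOp_conv hφ hF, mulOp_conv hφ hG,
    ← integral_add (hb F hF) (hb G hG)]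
  congr 1; ext y; ring

lemma int_norm_supp {φ : ℝ → ℂ} {l r A : ℝ} (hr : 0 ≤ r) 
    (h0 : ∀ ξ, ξ ∉ Set.Icc l (l + r) → φ ξ = 0) (hA : ∀ ξ, ‖φ ξ‖ ≤ A) :
    ∫ ξ, ‖φ ξ‖ ≤ A * r := by
  have h1 : ∫ ξ, ‖φ ξ‖ = ∫ ξ in Set.Icc l (l + r), ‖φ ξ‖ := by
    symm
    apply setIntegral_eq_integral_of_forall_compl_eq_zero
    intro x hx; simp [h0 x hx]
  rw [h1]
  have h2 := norm_setIntegral_le_of_norm_le_const (μ := volume) (s := Set.Icc l (l + r)) (C := A) (f := fun ξ => ‖φ ξ‖)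
    (by simp) (fun x _ => by simpa using hA x)
  refine (le_abs_self _).trans (h2.trans ?_)
  simp [Measure.real, hr]

lemma supp_hcs {φ : ℝ → ℂ} {l r : ℝ} (h0 : ∀ ξ, ξ ∉ Set.Ioo l (l + r) → φ ξ = 0) :
    tsupport φ ⊆ Set.Icc l (l + r) := by
  refine closure_minimal ?_ isClosed_Icc
  intro x hx
  by_contra hc
  exact hx (h0 x fun h => hc (Set.Ioo_subset_Icc_self h))

lemma kernel_bd {φ : ℝ → ℂ} {l L A B : ℝ} (hL : 0 < L) (hφ : ContDiff ℝ (⊤ : ℕ∞) φ)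
    (h0 : ∀ ξ, ξ ∉ Set.Ioo l (l + L⁻¹) → φ ξ = 0) (hA : ∀ ξ, ‖φ ξ‖ ≤ A)
    (hB : ∀ ξ, ‖iteratedDeriv 2 φ ξ‖ ≤ B * L ^ 2) :
    Integrable φ ∧ ∀ z, ‖𝓕⁻ φ z‖ ≤ (A + B) * L⁻¹ * (1 + (z / L) ^ 2)⁻¹ := by
  have hLi : (0:ℝ) ≤ L⁻¹ := by positivity
  have hts := supp_hcs h0
  have hcs : HasCompactSupport φ := isCompact_Icc.of_isClosed_subset (isClosed_tsupport _) hts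
  have hphiInt : Integrable φ := hφ.continuous.integrable_of_hasCompactSupport hcs
  have hids : ∀ m : ℕ, tsupport (iteratedDeriv m φ) ⊆ tsupport φ := by
    intro m
    induction m with
    | zero => simp
    | succ k ih => rw [iteratedDeriv_succ]; exact (tsupport_deriv_subset (𝕜 := ℝ)).trans ih
  have hidc : ∀ m : ℕ, Integrable (iteratedDeriv m φ) := by
    intro m
    refine Continuous.integrable_of_hasCompactSupport ?_ (hcs.of_isClosed_subset (isClosed_tsupport _) (hids m))
    exact hφ.continuous_iteratedDeriv m (by exact_mod_cast le_top)
  refine ⟨hphiInt, fun z => ?_⟩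
  have hf := Real.fourier_iteratedDeriv (N := ⊤) (n := 2) hφ (fun m _ => hidc m) le_top
  have h1 : ‖𝓕⁻ φ z‖ ≤ A * L⁻¹ :=
    (norm_fourierInv_le z).trans (int_norm_supp hLi (fun ξ hξ => h0 ξ fun h => hξ (Set.Ioo_subset_Icc_self h)) hA)
  have h2 : ‖𝓕 (iteratedDeriv 2 φ) (-z)‖ ≤ B * L ^ 2 * L⁻¹ := by
    refine (norm_fourier_le _).trans (int_norm_supp hLi (l := l) ?_ hB)
    intro ξ hξ
    exact image_eq_zero_of_notMem_tsupport fun h => hξ (hts (hids 2 h))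
  rw [hf] at h2
  simp only [smul_eq_mul, norm_mul, norm_pow] at h2
  rw [← fourierInv_eq_fourier_neg] at h2
  simp only [Complex.norm_real, Complex.norm_I, norm_neg, Complex.norm_ofNat, Complex.ofReal_neg] at h2
  set k := ‖𝓕⁻ φ z‖ with hk
  have hk0 : 0 ≤ k := norm_nonneg _
  have hz : (1 : ℝ) * ‖z‖ ≤ 2 * ‖π‖ * 1 * ‖z‖ := by
    have : (1:ℝ) ≤ ‖π‖ := by rw [Real.norm_of_nonneg pi_pos.le]; linarith [pi_gt_three]
    gcongr; linarith
  have h3 : z ^ 2 * k ≤ B * L ^ 2 * L⁻¹ := by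
    refine le_trans ?_ h2
    refine mul_le_mul_of_nonneg_right ?_ hk0
    rw [← sq_abs, ← Real.norm_eq_abs]
    gcongr
    linarith
  rw [← div_eq_mul_inv, le_div_iff₀ (by positivity)]
  have : k * (z / L) ^ 2 ≤ B * L⁻¹ := by
    rw [div_pow, ← mul_div_assoc, div_le_iff₀ (by positivity)]
    linarith [h3]
  nlinarith

open ComplexConjugate in
lemma prod_bump {φ ψ : ℝ → ℂ} {a0 a1 a2 L : ℝ} (hφ : ContDiff ℝ (⊤ : ℕ∞) φ)
    (hψ : ContDiff ℝ (⊤ : ℕ∞) ψ) (hL : 0 < L) 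
    (h0 : ∀ ξ, ‖φ ξ‖ ≤ a0) (h1 : ∀ ξ, ‖iteratedDeriv 1 φ ξ‖ ≤ a1 * L) (h2 : ∀ ξ, ‖iteratedDeriv 2 φ ξ‖ ≤ a2 * L ^ 2)
    (k0 : ∀ ξ, ‖ψ ξ‖ ≤ a0) (k1 : ∀ ξ, ‖iteratedDeriv 1 ψ ξ‖ ≤ a1 * L) (k2 : ∀ ξ, ‖iteratedDeriv 2 ψ ξ‖ ≤ a2 * L ^ 2) :
    ContDiff ℝ (⊤ : ℕ∞) (fun ξ => conj (φ ξ) * ψ ξ) ∧ (∀ ξ, ‖conj (φ ξ) * ψ ξ‖ ≤ a0 ^ 2) ∧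
    ∀ ξ, ‖iteratedDeriv 2 (fun ξ => conj (φ ξ) * ψ ξ) ξ‖ ≤ (2 * a0 * a2 + 2 * a1 ^ 2) * L ^ 2 := by
  have hc : ContDiff ℝ (⊤ : ℕ∞) (fun ξ => conj (φ ξ)) := Complex.conjCLE.contDiff.comp hφ
  refine ⟨hc.mul hψ, fun ξ => ?_, fun ξ => ?_⟩
  · rw [norm_mul, RCLike.norm_conj, sq]
    exact mul_le_mul (h0 ξ) (k0 ξ) (norm_nonneg _) ((norm_nonneg _).trans (h0 ξ))
  · have hcn : ∀ m : ℕ, ‖iteratedFDeriv ℝ m (fun ξ => conj (φ ξ)) ξ‖ = ‖iteratedDeriv m φ ξ‖ := by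
      intro m
      rw [← norm_iteratedFDeriv_eq_norm_iteratedDeriv]
      exact Complex.conjLIE.norm_iteratedFDeriv_comp_left φ ξ m
    have := norm_iteratedFDeriv_mul_le (𝕜 := ℝ) hc hψ ξ (n := 2) (show ((2 : ℕ∞) : WithTop ℕ∞) ≤ _ from WithTop.coe_le_coe.2 le_top)
    simp only [Finset.sum_range_succ, Finset.sum_range_zero, hcn] at this
    rw [norm_iteratedFDeriv_eq_norm_iteratedDeriv] at this
    simp only [norm_iteratedFDeriv_eq_norm_iteratedDeriv] at this
    refine this.trans ?_
    simp only [iteratedDeriv_zero] 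
    norm_num
    have e1 : ‖φ ξ‖ * ‖iteratedDeriv 2 ψ ξ‖ ≤ a0 * (a2 * L ^ 2) := mul_le_mul (h0 ξ) (k2 ξ) (norm_nonneg _) ((norm_nonneg _).trans (h0 ξ))
    have e2 : ‖iteratedDeriv 1 φ ξ‖ * ‖iteratedDeriv 1 ψ ξ‖ ≤ (a1 * L) * (a1 * L) := mul_le_mul (h1 ξ) (k1 ξ) (norm_nonneg _) ((norm_nonneg _).trans (h1 ξ))
    have e3 : ‖iteratedDeriv 2 φ ξ‖ * ‖ψ ξ‖ ≤ (a2 * L ^ 2) * a0 := mul_le_mul (h2 ξ) (k0 ξ) (norm_nonneg _) ((norm_nonneg _).trans (h2 ξ))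
    simp only [iteratedDeriv_one] at *
    nlinarith

def uu (L x : ℝ) : ℝ := (1 + (x / L) ^ 2)⁻¹

lemma uu_pos (L x : ℝ) : 0 < uu L x := by unfold uu; positivity
lemma uu_nonneg (L x : ℝ) : 0 ≤ uu L x := (uu_pos L x).le
lemma uu_le_one (L x : ℝ) : uu L x ≤ 1 := by
  unfold uu; apply inv_le_one_of_one_le₀; nlinarith [sq_nonneg (x / L)]
lemma uu_neg (L x : ℝ) : uu L (-x) = uu L x := by unfold uu; congr 2; ring
lemma uu_cont (L : ℝ) : Continuous (uu L) := by
  unfold uu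
  refine Continuous.inv₀ (by fun_prop) fun x => by positivity
lemma uu_int {L : ℝ} (hL : 0 < L) (c : ℝ) : Integrable (fun x => uu L (x - c)) := by
  unfold uu
  have := (integrable_inv_one_add_sq.comp_div hL.ne').comp_sub_right c
  exact this
lemma uu_int' {L : ℝ} (hL : 0 < L) (c : ℝ) : Integrable (fun x => uu L (c - x)) := by
  refine (uu_int hL c).congr (Filter.Eventually.of_forall fun x => ?_)
  simp only
  rw [← uu_neg]; congr 1; ring
lemma uu_integral {L : ℝ} (hL : 0 < L) (c : ℝ) : ∫ x, uu L (x - c) = π * L := by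
  rw [integral_sub_right_eq_self (fun x => uu L x)]
  unfold uu
  rw [Measure.integral_comp_div (fun x => (1 + x ^ 2)⁻¹), integral_univ_inv_one_add_sq, abs_of_pos hL, smul_eq_mul, mul_comm]
lemma uu_integral' {L : ℝ} (hL : 0 < L) (c : ℝ) : ∫ x, uu L (c - x) = π * L := by
  rw [← uu_integral hL c]
  congr 1; ext x; rw [← uu_neg]; congr 1; ring

lemma uu_mul_le (L x y c : ℝ) :
    uu L (x - y) * uu L (y - c) ≤ 2 * uu L (x - c) * (uu L (x - y) + uu L (y - c)) := by
  unfold uu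
  set s := (x - y) / L
  set t := (y - c) / L
  have : (x - c) / L = s + t := by simp only [s, t]; ring
  rw [this]
  have hs : 0 < 1 + s ^ 2 := by positivity
  have ht : 0 < 1 + t ^ 2 := by positivity
  have hst : 0 < 1 + (s + t) ^ 2 := by positivity
  rw [← sub_nonneg]
  have : 2 * (1 + (s + t) ^ 2)⁻¹ * ((1 + s ^ 2)⁻¹ + (1 + t ^ 2)⁻¹) - (1 + s ^ 2)⁻¹ * (1 + t ^ 2)⁻¹
    = (3 + (s - t) ^ 2) * ((1 + (s + t) ^ 2)⁻¹ * (1 + s ^ 2)⁻¹ * (1 + t ^ 2)⁻¹) := by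
    field_simp
    ring
  rw [this]; positivity

lemma uu_conv_int {L : ℝ} (hL : 0 < L) (x c : ℝ) :
    Integrable (fun y => uu L (x - y) * uu L (y - c)) := by
  refine (uu_int hL c).bdd_mul (c := 1) ?_ ?_
  · exact ((uu_cont L).comp (by fun_prop)).aestronglyMeasurable
  · exact Filter.Eventually.of_forall fun y => by
      rw [Real.norm_of_nonneg (uu_nonneg _ _)]; exact uu_le_one _ _

lemma uu_conv {L : ℝ} (hL : 0 < L) (x c : ℝ) :
    ∫ y, uu L (x - y) * uu L (y - c) ≤ 4 * π * L * uu L (x - c) := by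
  have h1 : ∫ y, uu L (x - y) * uu L (y - c) ≤ ∫ y, 2 * uu L (x - c) * (uu L (x - y) + uu L (y - c)) :=
    integral_mono (uu_conv_int hL x c) (((uu_int' hL x).add (uu_int hL c)).const_mul _) (fun y => uu_mul_le L x y c)
  refine h1.trans (le_of_eq ?_)
  rw [integral_const_mul, integral_add (uu_int' hL x) (uu_int hL c), uu_integral hL, uu_integral' hL]
  ring

lemma chi_pos {I : Iv} (hI : 0 < I.len) (x : ℝ) : 0 < I.chi x := by
  unfold Iv.chi
  have : 0 ≤ Metric.infDist x I.set := Metric.infDist_nonneg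
  positivity
lemma chi_le_one {I : Iv} (hI : 0 < I.len) (x : ℝ) : I.chi x ≤ 1 := by
  unfold Iv.chi
  have : 0 ≤ Metric.infDist x I.set := Metric.infDist_nonneg
  apply inv_le_one_of_one_le₀
  have : 0 ≤ Metric.infDist x I.set / I.len := by positivity
  linarith
lemma chi_cont {I : Iv} (hI : 0 < I.len) : Continuous I.chi := by
  unfold Iv.chi
  refine Continuous.inv₀ ?_ ?_
  · exact continuous_const.add ((Metric.continuous_infDist_pt _).div_const _)
  · intro x
    have : 0 ≤ Metric.infDist x I.set := Metric.infDist_nonneg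
    positivity
lemma chi_eq_one {I : Iv} (x : ℝ) (hx : x ∈ I.set) : I.chi x = 1 := by
  unfold Iv.chi; rw [Metric.infDist_zero_of_mem hx]; simp
lemma chi_sq_le {I : Iv} (hI : 0 < I.len) (x : ℝ) :
    I.chi x ^ 2 ≤ 4 * uu I.len (x - (I.l + I.len / 2)) := by
  have hne : I.set.Nonempty := ⟨I.l + I.len / 2, by unfold Iv.set; constructor <;> linarith⟩
  have hd : |x - (I.l + I.len / 2)| - I.len / 2 ≤ Metric.infDist x I.set := by
    rw [Metric.le_infDist hne]
    intro y hy
    rw [Real.dist_eq]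
    have : |y - (I.l + I.len / 2)| ≤ I.len / 2 := by
      rw [abs_le]; obtain ⟨h1, h2⟩ := hy; constructor <;> linarith
    have := abs_sub_le x y (I.l + I.len / 2)
    linarith
  have h0 : 0 ≤ Metric.infDist x I.set := Metric.infDist_nonneg
  unfold Iv.chi uu
  set d := Metric.infDist x I.set
  set t := x - (I.l + I.len / 2)
  set L := I.len
  have h1 : |t| / L - 1 / 2 ≤ d / L := by
    rw [show |t| / L - 1/2 = (|t| - L / 2) / L by field_simp]
    gcongr
  have h2 : 0 ≤ d / L := by positivity
  rw [← div_eq_mul_inv, inv_pow, inv_eq_one_div, div_le_div_iff₀ (by positivity) (by positivity)]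
  have h3 : (t / L) ^ 2 = (|t| / L) ^ 2 := by rw [div_pow, div_pow, sq_abs]
  rw [h3]
  have h4 : 0 ≤ |t| / L := by positivity
  nlinarith
lemma chi_pow_le {I : Iv} (hI : 0 < I.len) {N : ℕ} (hN : 1 ≤ N) (x : ℝ) :
    I.chi x ^ (2 * N) ≤ 4 * uu I.len (x - (I.l + I.len / 2)) := by
  refine le_trans ?_ (chi_sq_le hI x)
  exact pow_le_pow_of_le_one (chi_pos hI x).le (chi_le_one hI x) (by omega)

open ComplexConjugate in
lemma bessel {ι E : Type*} [NormedAddCommGroup E] [InnerProductSpace ℂ E] (s : Finset ι) (v : ι → E)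
    (F : E) (B : ℝ) (hB0 : 0 ≤ B) (hB : ∀ p ∈ s, ∑ q ∈ s, ‖inner ℂ (v p) (v q)‖ ≤ B) :
    ∑ p ∈ s, ‖inner ℂ (v p) F‖ ^ 2 ≤ B * ‖F‖ ^ 2 := by
  set c : ι → ℂ := fun p => inner ℂ (v p) F with hc
  set S := ∑ p ∈ s, ‖c p‖ ^ 2 with hS
  have hS0 : 0 ≤ S := Finset.sum_nonneg fun _ _ => by positivity
  set w := ∑ p ∈ s, c p • v p with hw
  have h1 : inner ℂ w F = (S : ℂ) := by
    rw [hw, sum_inner, hS]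
    push_cast
    refine Finset.sum_congr rfl fun p _ => ?_
    rw [inner_smul_left]
    exact Complex.conj_mul' (c p)
  have h2 : ‖w‖ ^ 2 ≤ B * S := by
    have h3 : ‖w‖ ^ 2 = ‖inner ℂ w w‖ := by rw [inner_self_eq_norm_sq_to_K]; simp
    have h4 : inner ℂ w w = ∑ p ∈ s, ∑ q ∈ s, (conj (c p) * (c q * inner ℂ (v p) (v q)) : ℂ) := by
      rw [hw, sum_inner]
      refine Finset.sum_congr rfl fun p _ => ?_
      rw [inner_sum]
      refine Finset.sum_congr rfl fun q _ => ?_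
      rw [inner_smul_left, inner_smul_right]
    rw [h3, h4]
    have h5 : ∀ p ∈ s, ∀ q ∈ s, ‖(conj (c p) * (c q * inner ℂ (v p) (v q)) : ℂ)‖ ≤
        ‖c p‖ ^ 2 / 2 * ‖inner ℂ (v p) (v q)‖ + ‖c q‖ ^ 2 / 2 * ‖inner ℂ (v q) (v p)‖ := by
      intro p _ q _
      rw [norm_mul, norm_mul, RCLike.norm_conj, norm_inner_symm (v q) (v p)]
      have := norm_nonneg (inner ℂ (v p) (v q))
      nlinarith [mul_nonneg (sq_nonneg (‖c p‖ - ‖c q‖)) this]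
    calc _ ≤ ∑ p ∈ s, ∑ q ∈ s, (‖c p‖ ^ 2 / 2 * ‖inner ℂ (v p) (v q)‖ + ‖c q‖ ^ 2 / 2 * ‖inner ℂ (v q) (v p)‖) := by
          refine (norm_sum_le _ _).trans (Finset.sum_le_sum fun p hp => ?_)
          exact (norm_sum_le _ _).trans (Finset.sum_le_sum fun q hq => h5 p hp q hq)
      _ = ∑ p ∈ s, ‖c p‖ ^ 2 * ∑ q ∈ s, ‖inner ℂ (v p) (v q)‖ := by
          simp only [Finset.sum_add_distrib]
          rw [Finset.sum_comm (f := fun p q => ‖c q‖ ^ 2 / 2 * ‖inner ℂ (v q) (v p)‖)]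
          rw [← Finset.sum_add_distrib]
          refine Finset.sum_congr rfl fun p _ => ?_
          rw [← Finset.mul_sum]; ring
      _ ≤ ∑ p ∈ s, ‖c p‖ ^ 2 * B := Finset.sum_le_sum fun p hp => by gcongr; exact hB p hp
      _ = B * S := by rw [← Finset.sum_mul, mul_comm]
  have h6 : S ≤ ‖w‖ * ‖F‖ := by
    have := norm_inner_le_norm (𝕜 := ℂ) w F
    rw [h1] at this
    simpa [abs_of_nonneg hS0] using this
  by_cases hSz : S = 0
  · rw [hSz]; positivity
  have hSp : 0 < S := lt_of_le_of_ne hS0 (Ne.symm hSz)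
  have h7 : S * S ≤ B * ‖F‖ ^ 2 * S := by
    have : S * S ≤ (‖w‖ * ‖F‖) * (‖w‖ * ‖F‖) := mul_self_le_mul_self hS0 h6
    nlinarith [mul_le_mul_of_nonneg_right h2 (sq_nonneg ‖F‖)]
  exact le_of_mul_le_mul_right h7 hSp

/-- kernel hypothesis -/
def KB (D L : ℝ) (φ : ℝ → ℂ) : Prop :=
  Integrable φ ∧ ∀ z, ‖𝓕⁻ φ z‖ ≤ D * L⁻¹ * uu L z

lemma mulOp_bd {D L : ℝ} {φ F : ℝ → ℂ} {g : ℝ → ℝ} (hφ : KB D L φ) (hF : Integrable F) (x : ℝ)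
    (hg : ∀ᵐ y, ‖F y‖ ≤ g y) (hgi : Integrable (fun y => uu L (x - y) * g y)) :
    ‖mulOp φ F x‖ ≤ D * L⁻¹ * ∫ y, uu L (x - y) * g y := by
  rw [mulOp_conv hφ.1 hF, ← integral_const_mul]
  refine norm_integral_le_of_norm_le (hgi.const_mul _) ?_
  filter_upwards [hg] with y hy
  rw [norm_mul]
  calc ‖F y‖ * ‖𝓕⁻ φ (x - y)‖ ≤ g y * (D * L⁻¹ * uu L (x - y)) :=
        mul_le_mul hy (hφ.2 _) (norm_nonneg _) ((norm_nonneg _).trans hy)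
    _ = _ := by ring

lemma KB.nonneg {D L : ℝ} {φ : ℝ → ℂ} (hφ : KB D L φ) (hL : 0 < L) : 0 ≤ D := by
  have h1 := (norm_nonneg _).trans (hφ.2 0)
  have h2 := uu_pos L 0
  by_contra hD
  push Not at hD
  have : D * L⁻¹ * uu L 0 < 0 := mul_neg_of_neg_of_pos (mul_neg_of_neg_of_pos hD (by positivity)) h2
  linarith

lemma mulOp_bd_inf {D L A : ℝ} {φ F : ℝ → ℂ} (hL : 0 < L) (hφ : KB D L φ) (hF : Integrable F) (x : ℝ)
    (hA : ∀ᵐ y, ‖F y‖ ≤ A) : ‖mulOp φ F x‖ ≤ D * π * A := by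
  refine (mulOp_bd hφ hF x hA ((uu_int' hL x).mul_const A)).trans (le_of_eq ?_)
  rw [integral_mul_const, uu_integral' hL]
  field_simp

lemma mulOp_bd_u {D L c : ℝ} {φ h : ℝ → ℂ} (hL : 0 < L) (hφ : KB D L φ) (hh : Integrable h) (x : ℝ)
    (hb : ∀ y, ‖h y‖ ≤ 4 * uu L (y - c)) : ‖mulOp φ h x‖ ≤ 16 * π * D * uu L (x - c) := by
  have hD := hφ.nonneg hL
  have e : (fun y => uu L (x - y) * (4 * uu L (y - c))) = fun y => 4 * (uu L (x - y) * uu L (y - c)) := by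
    ext y; ring
  refine (mulOp_bd hφ hh x (Filter.Eventually.of_forall hb) ?_).trans ?_
  · rw [e]; exact (uu_conv_int hL x c).const_mul _
  · rw [e, integral_const_mul]
    have := uu_conv hL x c
    calc D * L⁻¹ * (4 * ∫ y, uu L (x - y) * uu L (y - c)) ≤ D * L⁻¹ * (4 * (4 * π * L * uu L (x - c))) := by gcongr
      _ = _ := by field_simp; ring

lemma gram_bd {D L c c' : ℝ} {φ h h' : ℝ → ℂ} (hL : 0 < L) (hφ : KB D L φ) (hh' : Integrable h')
    (hb : ∀ y, ‖h y‖ ≤ 4 * uu L (y - c)) (hb' : ∀ y, ‖h' y‖ ≤ 4 * uu L (y - c')) :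
    ‖∫ x, mulOp φ h' x * h x‖ ≤ 256 * π ^ 2 * D * L * uu L (c - c') := by
  have hD := hφ.nonneg hL
  have h1 : ‖∫ x, mulOp φ h' x * h x‖ ≤ ∫ x, 64 * π * D * (uu L (c - x) * uu L (x - c')) := by
    refine norm_integral_le_of_norm_le ((uu_conv_int hL c c').const_mul _) (Filter.Eventually.of_forall fun x => ?_)
    rw [norm_mul]
    calc ‖mulOp φ h' x‖ * ‖h x‖ ≤ (16 * π * D * uu L (x - c')) * (4 * uu L (x - c)) := 
          mul_le_mul (mulOp_bd_u hL hφ hh' x hb') (hb x) (norm_nonneg _) (by have := uu_nonneg L (x - c'); positivity)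
      _ = _ := by rw [← uu_neg L (x - c), neg_sub]; ring
  refine h1.trans ?_
  rw [integral_const_mul]
  have := uu_conv hL c c'
  calc _ ≤ 64 * π * D * (4 * π * L * uu L (c - c')) := by gcongr
    _ = _ := by ring

open ComplexConjugate in
lemma conj_fourierInv (h : ℝ → ℂ) (ξ : ℝ) : conj (𝓕⁻ h ξ) = 𝓕 (fun x => conj (h x)) ξ := by
  rw [Real.fourier_eq', fourierInv_eq', ← integral_conj]
  congr 1; ext x
  simp only [smul_eq_mul, map_mul, ← Complex.exp_conj]
  congr 2
  simp [Complex.conj_ofNat]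

open ComplexConjugate in
lemma local_sum {ι : Type*} (s : Finset ι) (L c lf : ι → ℝ) (ψ h : ι → ℝ → ℂ) (a0 a1 a2 R : ℝ)
    (ha0 : 0 ≤ a0) (ha2 : 0 ≤ a2) (hR : 0 ≤ R) (hL : ∀ p, 0 < L p) (hψ : ∀ p, ContDiff ℝ (⊤ : ℕ∞) (ψ p))
    (hs : ∀ p ξ, ξ ∉ Set.Ioo (lf p) (lf p + (L p)⁻¹) → ψ p ξ = 0)
    (h0 : ∀ p ξ, ‖ψ p ξ‖ ≤ a0) (h1 : ∀ p ξ, ‖iteratedDeriv 1 (ψ p) ξ‖ ≤ a1 * L p)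
    (h2 : ∀ p ξ, ‖iteratedDeriv 2 (ψ p) ξ‖ ≤ a2 * L p ^ 2)
    (hh : ∀ p, Integrable (h p)) (hb : ∀ p y, ‖h p y‖ ≤ 4 * uu (L p) (y - c p))
    (hdis : ∀ p ∈ s, ∀ q ∈ s, L p ≠ L q → ∀ ξ, ξ ∈ Set.Ioo (lf p) (lf p + (L p)⁻¹) → 
      ξ ∉ Set.Ioo (lf q) (lf q + (L q)⁻¹))
    (hrow : ∀ p ∈ s, ∑ q ∈ s, (if L q = L p then uu (L p) (c p - c q) else 0) ≤ R)
    (F : ℝ → ℂ) (hF : Integrable F) (hF2 : MemLp F 2) :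
    ∑ p ∈ s, (L p)⁻¹ * ‖∫ x, mulOp (ψ p) F x * h p x‖ ^ 2 ≤
      256 * π ^ 2 * (a0 ^ 2 + (2 * a0 * a2 + 2 * a1 ^ 2)) * R * ‖hF2.toLp F‖ ^ 2 := by
  set D := a0 ^ 2 + (2 * a0 * a2 + 2 * a1 ^ 2) with hDdef
  have hphiInt : ∀ p, Integrable (ψ p) := fun p =>
    (kernel_bd (hL p) (hψ p) (hs p) (h0 p) (h2 p)).1
  have hcs : ∀ p, HasCompactSupport (ψ p) := fun p =>
    isCompact_Icc.of_isClosed_subset (isClosed_tsupport _) (supp_hcs (hs p))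
  have hprod : ∀ p q, L q = L p → KB D (L p) (fun ξ => conj (ψ q ξ) * ψ p ξ) := by
    intro p q e
    obtain ⟨k1, k2, k3⟩ := prod_bump (hψ q) (hψ p) (hL p) (h0 q) (e ▸ h1 q) (e ▸ h2 q) (h0 p) (h1 p) (h2 p)
    exact kernel_bd (l := lf p) (hL p) k1 (fun ξ hξ => by simp [hs p ξ hξ]) k2 k3
  have hD : 0 ≤ D := by positivity
  set G : ι → ℝ → ℂ := fun p ξ => conj (ψ p ξ * 𝓕⁻ (h p) ξ) with hG
  have hGc : ∀ p, Continuous (G p) := fun p =>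
    Complex.continuous_conj.comp ((hψ p).continuous.mul (cont_fourierInv (hh p)))
  have hGs : ∀ p, HasCompactSupport (G p) := fun p => by
    refine (hcs p).mono ?_
    intro ξ hξ hc
    apply hξ
    simp [hG, hc]
  have hGm : ∀ p, MemLp (G p) 2 volume := fun p => (hGc p).memLp_of_hasCompactSupport (hGs p)
  set v : ι → Lp ℂ 2 (volume : Measure ℝ) := fun p => (((√(L p))⁻¹ : ℝ) : ℂ) • (hGm p).toLp (G p) with hv
  have hsq : ∀ p, (√(L p))⁻¹ * (√(L p))⁻¹ = (L p)⁻¹ := fun p => by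
    rw [← mul_inv, Real.mul_self_sqrt (hL p).le]
  have hinn : ∀ p, inner ℂ ((hGm p).toLp (G p)) ((plancherel_memLp hF hF2).toLp (𝓕 F)) =
      ∫ x, mulOp (ψ p) F x * h p x := by
    intro p
    rw [mulOp_pair (hphiInt p) hF (hh p), MeasureTheory.L2.inner_def]
    apply integral_congr_ae
    filter_upwards [(hGm p).coeFn_toLp, (plancherel_memLp hF hF2).coeFn_toLp] with ξ e1 e2
    rw [e1, e2, RCLike.inner_apply]
    simp only [hG, Complex.conj_conj]
    ring
  have hgram : ∀ p q, inner ℂ ((hGm p).toLp (G p)) ((hGm q).toLp (G q)) =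
      ∫ ξ, (conj (ψ q ξ) * ψ p ξ) * 𝓕 (fun x => conj (h q x)) ξ * 𝓕⁻ (h p) ξ := by
    intro p q
    rw [MeasureTheory.L2.inner_def]
    apply integral_congr_ae
    filter_upwards [(hGm p).coeFn_toLp, (hGm q).coeFn_toLp] with ξ e1 e2
    rw [e1, e2, RCLike.inner_apply]
    simp only [hG, Complex.conj_conj, map_mul, ← conj_fourierInv]
    ring
  have hhc : ∀ q, Integrable (fun x => conj (h q x)) := fun q =>
    (Complex.conjLIE.integrable_comp_iff (φ := h q)).2 (hh q)
  have hgb : ∀ p ∈ s, ∀ q ∈ s, ‖inner ℂ (v p) (v q)‖ ≤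
      256 * π ^ 2 * D * (if L q = L p then uu (L p) (c p - c q) else 0) := by
    intro p hp q hq
    simp only [hv]
    rw [inner_smul_left, inner_smul_right, norm_mul, norm_mul, hgram]
    simp only [Complex.conj_ofReal, Complex.norm_real, Real.norm_eq_abs]
    rw [abs_of_nonneg (by positivity), abs_of_nonneg (by positivity)]
    split_ifs with e
    · rw [← mulOp_pair (φ := fun ξ => conj (ψ q ξ) * ψ p ξ) (hprod p q e).1 (hhc q) (hh p)]
      have := gram_bd (hL p) (hprod p q e) (hhc q) (hb p) (c' := c q) (fun y => by
        rw [RCLike.norm_conj, ← e]; exact hb q y)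
      rw [← mul_assoc, e, hsq]
      calc (L p)⁻¹ * _ ≤ (L p)⁻¹ * _ := mul_le_mul_of_nonneg_left this (by have := hL p; positivity)
        _ = _ := by have := (hL p).ne'; field_simp
    · have : ∀ ξ, (conj (ψ q ξ) * ψ p ξ) * 𝓕 (fun x => conj (h q x)) ξ * 𝓕⁻ (h p) ξ = 0 := by
        intro ξ
        by_cases hξ : ξ ∈ Set.Ioo (lf p) (lf p + (L p)⁻¹)
        · rw [hs q ξ (hdis p hp q hq (Ne.symm e) ξ hξ)]; simp
        · rw [hs p ξ hξ]; simp
      simp [this]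
  have key := bessel s v ((plancherel_memLp hF hF2).toLp (𝓕 F)) (256 * π ^ 2 * D * R) (by positivity) (by
    intro p hp
    refine (Finset.sum_le_sum fun q hq => hgb p hp q hq).trans ?_
    rw [← Finset.mul_sum]
    exact mul_le_mul_of_nonneg_left (hrow p hp) (by positivity))
  rw [plancherel_norm hF hF2] at key
  refine le_trans (le_of_eq ?_) key
  refine Finset.sum_congr rfl fun p hp => ?_
  simp only [hv]
  rw [inner_smul_left, hinn, norm_mul, mul_pow]
  simp only [Complex.conj_ofReal, Complex.norm_real, Real.norm_eq_abs]
  rw [abs_of_nonneg (by positivity), sq (√(L p))⁻¹, hsq]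

def vv (L x : ℝ) : ℝ := uu L x ^ (3/4 : ℝ)
def VV : ℝ := ∫ x, vv 1 x
lemma vv_nonneg (L x : ℝ) : 0 ≤ vv L x := rpow_nonneg (uu_nonneg _ _) _
lemma vv_one_int : Integrable (vv 1) := by
  have := integrable_rpow_neg_one_add_norm_sq (E := ℝ) (μ := volume) (r := 3/2) (by norm_num)
  refine this.congr (Filter.Eventually.of_forall fun x => ?_)
  simp only [vv, uu, div_one, norm_eq_abs, sq_abs]
  rw [Real.inv_rpow (by positivity), ← Real.rpow_neg (by positivity)]
  norm_num
lemma vv_eq (L x : ℝ) : vv L x = vv 1 (x / L) := by simp [vv, uu]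
lemma vv_int {L : ℝ} (hL : 0 < L) (c : ℝ) : Integrable (fun x => vv L (x - c)) := by
  simp_rw [vv_eq L]
  exact (vv_one_int.comp_div hL.ne').comp_sub_right c
lemma vv_neg (L x : ℝ) : vv L (-x) = vv L x := by unfold vv; rw [uu_neg]
lemma vv_int' {L : ℝ} (hL : 0 < L) (c : ℝ) : Integrable (fun x => vv L (c - x)) := by
  refine (vv_int hL c).congr (Filter.Eventually.of_forall fun x => ?_)
  simp only
  rw [← vv_neg]; congr 1; ring
lemma vv_integral {L : ℝ} (hL : 0 < L) (c : ℝ) : ∫ x, vv L (x - c) = L * VV := by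
  rw [integral_sub_right_eq_self (fun x => vv L x)]
  simp_rw [vv_eq L]
  rw [Measure.integral_comp_div (vv 1), abs_of_pos hL, smul_eq_mul, VV]
lemma vv_integral' {L : ℝ} (hL : 0 < L) (c : ℝ) : ∫ x, vv L (c - x) = L * VV := by
  rw [← vv_integral hL c]
  congr 1; ext x; rw [← vv_neg]; congr 1; ring
lemma VV_nonneg : 0 ≤ VV := integral_nonneg fun x => vv_nonneg 1 x

lemma uu_tail {L M s t : ℝ} (hL : 0 < L) (hM : 0 < M) (hst : M ≤ |s - t|) :
    uu L s * uu L t ≤ √(2 * L / M) * (vv L s * vv L t) := by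
  have h1 : uu L s * uu L t = (uu L s * uu L t) ^ (1/4 : ℝ) * (vv L s * vv L t) := by
    rw [vv, vv, ← Real.mul_rpow (uu_nonneg _ _) (uu_nonneg _ _), ← Real.rpow_add (mul_pos (uu_pos _ _) (uu_pos _ _))]
    norm_num
  rw [h1]
  refine mul_le_mul_of_nonneg_right ?_ (mul_nonneg (vv_nonneg _ _) (vv_nonneg _ _))
  have h2 : uu L s * uu L t ≤ (2 * L / M) ^ 2 := by
    unfold uu
    rw [← mul_inv]
    have : (M / L) ^ 2 ≤ ((s - t) / L) ^ 2 := by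
      rw [div_pow, div_pow, ← sq_abs (s - t)]
      gcongr
    rw [sub_div] at this
    have h3 : (M / (2 * L)) ^ 2 ≤ (1 + (s / L) ^ 2) * (1 + (t / L) ^ 2) := by
      have e : (M / (2 * L)) ^ 2 = (M / L) ^ 2 / 4 := by field_simp; norm_num
      rw [e]
      nlinarith [sq_nonneg (s / L + t / L), sq_nonneg (s / L * (t / L)), sq_nonneg (s/L), sq_nonneg (t/L)]
    calc _ ≤ ((M / (2 * L)) ^ 2)⁻¹ := inv_anti₀ (by positivity) h3
      _ = _ := by rw [← inv_pow, inv_div]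
  calc (uu L s * uu L t) ^ (1/4 : ℝ) ≤ ((2 * L / M) ^ 2) ^ (1/4 : ℝ) :=
        Real.rpow_le_rpow (mul_nonneg (uu_nonneg _ _) (uu_nonneg _ _)) h2 (by norm_num)
    _ = √(2 * L / M) := by
        rw [Real.sqrt_eq_rpow, ← Real.rpow_natCast, ← Real.rpow_mul (by positivity)]
        norm_num

lemma W_int {L c : ℝ} {W : ℝ → ℝ} (hL : 0 < L) (hWc : Continuous W) (hW0 : ∀ x, 0 ≤ W x)
    (hW : ∀ x, W x ≤ 4 * uu L (x - c)) : Integrable W := by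
  refine ((uu_int hL c).const_mul 4).mono' hWc.aestronglyMeasurable (Filter.Eventually.of_forall fun x => ?_)
  rw [Real.norm_of_nonneg (hW0 x)]; exact hW x

lemma mulOp_W_int {D L c A : ℝ} {W : ℝ → ℝ} {φ F : ℝ → ℂ} (hL : 0 < L) (hφ : KB D L φ) (hF : Integrable F)
    (hA : ∀ᵐ y, ‖F y‖ ≤ A) (hWc : Continuous W) (hW0 : ∀ x, 0 ≤ W x)
    (hW : ∀ x, W x ≤ 4 * uu L (x - c)) : Integrable (fun x => ‖mulOp φ F x‖ * W x) := by
  refine (W_int hL hWc hW0 hW).bdd_mul (c := D * π * A) (mulOp_cont hφ.1 hF).norm.aestronglyMeasurable ?_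
  exact Filter.Eventually.of_forall fun x => by
    rw [norm_norm]; exact mulOp_bd_inf hL hφ hF x hA

lemma sup_bd {D L c A : ℝ} {W : ℝ → ℝ} {φ F : ℝ → ℂ} (hL : 0 < L) (hφ : KB D L φ) (hF : Integrable F)
    (hA0 : 0 ≤ A) (hA : ∀ᵐ y, ‖F y‖ ≤ A) (hWc : Continuous W) (hW0 : ∀ x, 0 ≤ W x)
    (hW : ∀ x, W x ≤ 4 * uu L (x - c)) : L⁻¹ * ∫ x, ‖mulOp φ F x‖ * W x ≤ 4 * D * π ^ 2 * A := by
  have hD := hφ.nonneg hL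
  have h1 : ∫ x, ‖mulOp φ F x‖ * W x ≤ ∫ x, (D * π * A) * (4 * uu L (x - c)) := by
    refine integral_mono (mulOp_W_int hL hφ hF hA hWc hW0 hW) (((uu_int hL c).const_mul 4).const_mul _) fun x => ?_
    exact mul_le_mul (mulOp_bd_inf hL hφ hF x hA) (hW x) (hW0 x) (by positivity)
  rw [integral_const_mul, integral_const_mul, uu_integral hL] at h1
  calc _ ≤ L⁻¹ * (D * π * A * (4 * (π * L))) := by gcongr
    _ = _ := by field_simp

lemma tail_bd {D L c A M : ℝ} {W : ℝ → ℝ} {φ F : ℝ → ℂ} (hL : 0 < L) (hM : 0 < M) (hφ : KB D L φ) (hF : Integrable F)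
    (hA0 : 0 ≤ A) (hA : ∀ᵐ y, ‖F y‖ ≤ A) (hout : ∀ y, |y - c| < M → F y = 0)
    (hWc : Continuous W) (hW0 : ∀ x, 0 ≤ W x)
    (hW : ∀ x, W x ≤ 4 * uu L (x - c)) :
    (L⁻¹ * ∫ x, ‖mulOp φ F x‖ * W x) ^ 2 ≤ 32 * D ^ 2 * VV ^ 4 * A ^ 2 * (L / M) := by
  have hD := hφ.nonneg hL
  set g : ℝ → ℝ := fun y => if |y - c| < M then 0 else A with hg
  have hgA : ∀ y, ‖g y‖ ≤ A := fun y => by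
    simp only [hg]; split_ifs <;> simp [hA0, abs_of_nonneg]
  have hgm : Measurable g := Measurable.ite (measurableSet_lt (by fun_prop) measurable_const) measurable_const measurable_const
  have hgi : ∀ x, Integrable (fun y => uu L (x - y) * g y) := fun x =>
    (uu_int' hL x).mul_bdd hgm.aestronglyMeasurable (Filter.Eventually.of_forall hgA)
  have hFg : ∀ᵐ y, ‖F y‖ ≤ g y := by
    filter_upwards [hA] with y hy
    simp only [hg]; split_ifs with h
    · simp [hout y h]
    · exact hy
  have hV := VV_nonneg
  have hpt : ∀ x, ‖mulOp φ F x‖ * W x ≤ 4 * D * A * √(2 * L / M) * VV * vv L (x - c) := by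
    intro x
    have h1 := mulOp_bd hφ hF x hFg (hgi x)
    have h2 : uu L (x - c) * ∫ y, uu L (x - y) * g y ≤ A * √(2 * L / M) * vv L (x - c) * (L * VV) := by
      rw [← vv_integral' hL x, ← integral_const_mul, ← integral_const_mul]
      refine integral_mono ((hgi x).const_mul _) ((vv_int' hL x).const_mul _) fun y => ?_
      simp only [hg]
      split_ifs with h
      · have := vv_nonneg L (x - c)
        have := vv_nonneg L (x - y)
        simp; positivity
      · push Not at h
        have := uu_tail (s := x - y) (t := x - c) hL hM (by rw [show x - y - (x - c) = -(y - c) by ring, abs_neg]; exact h)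
        calc _ = A * (uu L (x - y) * uu L (x - c)) := by ring
          _ ≤ A * _ := mul_le_mul_of_nonneg_left this hA0
          _ = _ := by ring
    calc ‖mulOp φ F x‖ * W x ≤ (D * L⁻¹ * ∫ y, uu L (x - y) * g y) * (4 * uu L (x - c)) :=
          mul_le_mul h1 (hW x) (hW0 x) ((norm_nonneg _).trans h1)
      _ = 4 * D * L⁻¹ * (uu L (x - c) * ∫ y, uu L (x - y) * g y) := by ring
      _ ≤ 4 * D * L⁻¹ * (A * √(2 * L / M) * vv L (x - c) * (L * VV)) := by gcongr
      _ = _ := by field_simp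
  have h3 : ∫ x, ‖mulOp φ F x‖ * W x ≤ ∫ x, 4 * D * A * √(2 * L / M) * VV * vv L (x - c) :=
    integral_mono (mulOp_W_int hL hφ hF hA hWc hW0 hW) ((vv_int hL c).const_mul _) hpt
  rw [integral_const_mul, vv_integral hL] at h3
  have h4 : 0 ≤ ∫ x, ‖mulOp φ F x‖ * W x := integral_nonneg fun x => mul_nonneg (norm_nonneg _) (hW0 x)
  calc _ ≤ (L⁻¹ * (4 * D * A * √(2 * L / M) * VV * (L * VV))) ^ 2 := by gcongr
    _ = (4 * D * A * VV ^ 2) ^ 2 * √(2 * L / M) ^ 2 := by field_simp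
    _ = _ := by rw [Real.sq_sqrt (by positivity)]; ring

open ComplexConjugate in
lemma sign_fn {L c : ℝ} {W : ℝ → ℝ} {g : ℝ → ℂ} (hg : Continuous g) (hL : 0 < L) (hWc : Continuous W)
    (hW0 : ∀ x, 0 ≤ W x) (hW : ∀ x, W x ≤ 4 * uu L (x - c)) :
    ∃ h : ℝ → ℂ, Integrable h ∧ (∀ y, ‖h y‖ ≤ 4 * uu L (y - c)) ∧
      ∫ x, g x * h x = ((∫ x, ‖g x‖ * W x : ℝ) : ℂ) := by
  have hb : ∀ y, ‖conj (g y) / ‖g y‖ * W y‖ ≤ W y := by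
    intro y
    rw [norm_mul, norm_div, RCLike.norm_conj, Complex.norm_real, Complex.norm_real, norm_norm, Real.norm_of_nonneg (hW0 y)]
    exact mul_le_of_le_one_left (hW0 y) (div_self_le_one _)
  have hm : Measurable (fun y => conj (g y) / ‖g y‖ * (W y : ℂ)) := by
    have h1 := hg.measurable
    have h2 : Measurable (fun y => conj (g y)) := (Complex.continuous_conj.comp hg).measurable
    have h3 : Measurable (fun y => ((‖g y‖ : ℝ) : ℂ)) := (Complex.continuous_ofReal.comp hg.norm).measurable
    have h4 : Measurable (fun y => (W y : ℂ)) := (Complex.continuous_ofReal.comp hWc).measurable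
    exact (h2.div h3).mul h4
  refine ⟨fun y => conj (g y) / ‖g y‖ * W y, ?_, fun y => (hb y).trans (hW y), ?_⟩
  · exact (W_int hL hWc hW0 hW).mono' hm.aestronglyMeasurable (Filter.Eventually.of_forall hb)
  · rw [← integral_complex_ofReal]
    congr 1; ext x
    push_cast
    by_cases h : g x = 0
    · simp [h]
    · have : (‖g x‖ : ℂ) ≠ 0 := by simpa using h
      rw [← mul_assoc, ← mul_div_assoc, Complex.mul_conj']
      field_simp

lemma ae_bd {f : ℝ → ℂ} {N : ℕ} {A : ℝ} (hf : Integrable f)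
    (h : ∀ I : Iv, 0 < I.len → (∫ x, ‖f x‖ * I.chi x ^ N) ≤ A * I.len) : ∀ᵐ x, ‖f x‖ ≤ A := by
  have hl : LocallyIntegrable (fun x => ‖f x‖) := hf.norm.locallyIntegrable
  filter_upwards [IsUnifLocDoublingMeasure.ae_tendsto_average (μ := volume) hl 1] with x hx
  have := hx (l := nhdsWithin 0 (Set.Ioi 0)) (fun _ => x) (fun r => r) Filter.tendsto_id (by
    filter_upwards [self_mem_nhdsWithin] with r hr
    simp only [one_mul]
    exact Metric.mem_closedBall_self (le_of_lt hr))
  refine le_of_tendsto this ?_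
  filter_upwards [self_mem_nhdsWithin] with r hr
  have hr : 0 < r := hr
  have hI := h ⟨x - r, 2 * r⟩ (by simpa using hr)
  have hle : ∫ y in Metric.closedBall x r, ‖f y‖ ≤ ∫ y, ‖f y‖ * (Iv.chi ⟨x - r, 2 * r⟩ y) ^ N := by
    rw [Real.closedBall_eq_Icc, integral_Icc_eq_integral_Ioo, ← integral_indicator measurableSet_Ioo]
    have hlen : 0 < (⟨x - r, 2 * r⟩ : Iv).len := by simpa using hr
    refine integral_mono (hf.norm.indicator measurableSet_Ioo) ?_ fun y => ?_
    · refine hf.norm.mul_bdd (c := 1) ((chi_cont hlen).pow N).aestronglyMeasurable (Filter.Eventually.of_forall fun y => ?_)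
      rw [norm_pow, Real.norm_of_nonneg (chi_pos hlen y).le]
      exact pow_le_one₀ (chi_pos hlen y).le (chi_le_one hlen y)
    · by_cases hy : y ∈ Set.Ioo (x - r) (x + r)
      · simp only [Set.indicator_of_mem hy]
        rw [chi_eq_one]
        · simp
        · unfold Iv.set; simp only; constructor <;> linarith [hy.1, hy.2]
      · simp only [Set.indicator_of_notMem hy]
        have := (chi_pos hlen y).le
        positivity
  rw [setAverage_eq, smul_eq_mul, Real.volume_real_closedBall hr.le]
  simp only at hI
  rw [inv_mul_le_iff₀ (by positivity)]
  linarith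

lemma lesim_geom {β c : ℝ} {P' P : Tile} (h : Tile.lesim β c P' P) :
    P'.j ≤ P.j ∧ (2:ℝ)^P.j * P.kt ≤ (2:ℝ)^P'.j * P'.kt ∧
    (2:ℝ)^P'.j * P'.kt + (2:ℝ)^P'.j ≤ (2:ℝ)^P.j * P.kt + (2:ℝ)^P.j ∧
    |((P.freqIv β).l + (P.freqIv β).len / 2) - ((P'.freqIv β).l + (P'.freqIv β).len / 2)|
      < c * (2:ℝ)^(-P'.j) / 2 := by
  obtain ⟨h1, h2⟩ := h
  have p1 : (0:ℝ) < 2^P'.j := by positivity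
  have p2 : (0:ℝ) < 2^(-P.j) := by positivity
  unfold Iv.set Tile.timeIv at h1
  simp only at h1
  rw [Set.Ioo_subset_Ioo_iff (by linarith)] at h1
  refine ⟨?_, h1.1, h1.2, ?_⟩
  · rw [← zpow_le_zpow_iff_right₀ (a := (2:ℝ)) (by norm_num)]
    linarith [h1.1, h1.2]
  · have hm : (P.freqIv β).l + (P.freqIv β).len / 2 ∈ (P.freqIv β).set := by
      have : (P.freqIv β).len = 2^(-P.j) := rfl
      constructor <;> rw [this] <;> linarith
    have := h2 hm
    unfold Iv.dil at this
    have hl : (P'.freqIv β).len = 2^(-P'.j) := rfl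
    rw [abs_lt]
    rw [hl] at this ⊢
    constructor <;> linarith [this.1, this.2]

lemma lesim'_geom {β c : ℝ} {P' P : Tile} (h : Tile.lesim' β c P' P) (hj : P'.j < P.j) {ξ : ℝ}
    (hξ : ξ ∈ (P'.freqIv β).set) :
    3/4 * (2:ℝ)^(-P'.j) ≤ |ξ - ((P.freqIv β).l + (P.freqIv β).len / 2)| ∧
    |ξ - ((P.freqIv β).l + (P.freqIv β).len / 2)| < (c + 1) / 2 * (2:ℝ)^(-P'.j) := by
  obtain ⟨-, -, -, h4⟩ := lesim_geom h.1
  have p1 : (0:ℝ) < 2^P'.j := by positivity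
  have p2 : (0:ℝ) < 2^(-P.j) := by positivity
  have hlt : (2:ℝ)^P'.j < 2^P.j := (zpow_lt_zpow_iff_right₀ (by norm_num)).2 hj
  have hhalf : (2:ℝ)^(-P.j) ≤ 2^(-P'.j) / 2 := by
    have : (2:ℝ)^(-P'.j) / 2 = 2^(-P'.j - 1) := by rw [zpow_sub_one₀ (by norm_num)]; ring
    rw [this]
    exact zpow_le_zpow_right₀ (by norm_num) (by omega)
  have hns : ¬ (P.freqIv β).set ⊆ (P'.freqIv β).dil 3 := by
    intro hs
    apply h.2
    left
    refine ⟨⟨h.1.1, fun hss => ?_⟩, hs⟩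
    unfold Iv.set Tile.timeIv at hss
    simp only at hss
    rw [Set.Ioo_subset_Ioo_iff (by linarith)] at hss
    linarith [hss.1, hss.2]
  have hl : (P.freqIv β).len = 2^(-P.j) := rfl
  have hl' : (P'.freqIv β).len = 2^(-P'.j) := rfl
  unfold Iv.set Iv.dil at hns
  rw [Set.Ioo_subset_Ioo_iff (by rw [hl]; linarith)] at hns
  obtain ⟨q1, q2⟩ := hξ
  rw [hl'] at q2
  rw [hl, hl'] at hns h4
  rw [hl]
  rw [abs_lt] at h4
  constructor
  · rw [le_abs]
    by_contra hc
    push Not at hc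
    apply hns
    constructor
    · linarith [hc.1, hc.2]
    · linarith [hc.1, hc.2]
  · rw [abs_lt]; constructor <;> linarith [h4.1, h4.2]

lemma card_Icc_le (s c : ℝ) (hc : 0 < c) : (Finset.Icc ⌈s - c/2⌉ ⌊s + c/2⌋).card ≤ ⌊c + 1⌋₊ := by
  rw [Int.card_Icc]
  apply Nat.le_floor
  have h1 : ((⌊s + c/2⌋ + 1 - ⌈s - c/2⌉ : ℤ) : ℝ) ≤ c + 1 := by
    push_cast
    linarith [Int.floor_le (s + c/2), Int.le_ceil (s - c/2)]
  rcases le_total 0 (⌊s + c/2⌋ + 1 - ⌈s - c/2⌉) with h | h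
  · have : (((⌊s + c/2⌋ + 1 - ⌈s - c/2⌉).toNat : ℤ) : ℝ) = ((⌊s + c/2⌋ + 1 - ⌈s - c/2⌉ : ℤ) : ℝ) := by
      rw [Int.toNat_of_nonneg h]
    rw [← this] at h1
    exact_mod_cast h1
  · rw [Int.toNat_of_nonpos h]; simp; linarith

/-- number of multi-tiles with given time interval -/
def RR (n : ℕ) (c : ℝ) : ℕ := ⌊c + 1⌋₊ ^ n

lemma count_key {n : ℕ} {α : Fin n → ℝ} {c : ℝ} (hc : 0 < c) (T : Finset (MultiTile n)) (PT : MultiTile n)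
    (hT : ∀ P ∈ T, ∀ i, Tile.lesim (α i) c (P.tile i) (PT.tile i)) (j k : ℤ) :
    (T.filter (fun P => P.j = j ∧ P.kt = k)).card ≤ RR n c := by
  set s : Fin n → ℝ := fun i => (2:ℝ)^j * ((((PT.tile i).freqIv (α i)).l + ((PT.tile i).freqIv (α i)).len / 2))
    - (-1:ℝ)^(-j) * α i - 1/2 with hs
  have h1 : (T.filter (fun P => P.j = j ∧ P.kt = k)).card ≤
      (Fintype.piFinset (fun i => Finset.Icc ⌈s i - c/2⌉ ⌊s i + c/2⌋)).card := by
    apply Finset.card_le_card_of_injOn (fun P => P.kf)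
    · intro P hP
      simp only [Finset.coe_filter, Set.mem_ofPred_eq] at hP
      obtain ⟨hP, rfl, rfl⟩ := hP
      simp only [Finset.mem_coe, Fintype.mem_piFinset, Finset.mem_Icc]
      intro i
      have := (lesim_geom (hT P hP i)).2.2.2
      have e1 : ((P.tile i).freqIv (α i)).l = (2:ℝ)^(-P.j) * ((P.kf i : ℝ) + (-1:ℝ)^(-P.j) * α i) := rfl
      have e2 : ((P.tile i).freqIv (α i)).len = (2:ℝ)^(-P.j) := rfl
      have e3 : (P.tile i).j = P.j := rfl
      rw [e1, e2, e3] at this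
      have p : (0:ℝ) < 2^P.j := by positivity
      have h5 := mul_lt_mul_of_pos_left this p
      rw [← abs_of_pos p, ← abs_mul, abs_of_pos p] at h5
      have e4 : (2:ℝ)^P.j * (((PT.tile i).freqIv (α i)).l + ((PT.tile i).freqIv (α i)).len / 2 -
          ((2:ℝ)^(-P.j) * ((P.kf i : ℝ) + (-1:ℝ)^(-P.j) * α i) + (2:ℝ)^(-P.j) / 2)) = s i - P.kf i := by
        simp only [hs]
        have : (2:ℝ)^(-P.j) = (2^P.j)⁻¹ := zpow_neg _ _
        rw [this]
        field_simp
        ring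
      have e5 : (2:ℝ)^P.j * (c * (2:ℝ)^(-P.j) / 2) = c / 2 := by
        rw [zpow_neg]; field_simp
      rw [e4, e5, abs_lt] at h5
      constructor
      · apply Int.ceil_le.2; linarith [h5.1, h5.2]
      · apply Int.le_floor.2; linarith [h5.1, h5.2]
    · intro P hP Q hQ hPQ
      simp only [Finset.coe_filter, Set.mem_ofPred_eq] at hP hQ
      cases P; cases Q
      simp_all
  refine h1.trans ?_
  rw [Fintype.card_piFinset, RR]
  calc _ ≤ ∏ i : Fin n, ⌊c + 1⌋₊ := Finset.prod_le_prod' fun i _ => card_Icc_le _ _ hc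
    _ = _ := by simp

lemma fiber_sum {ι κ : Type*} [DecidableEq κ] (s : Finset ι) (key : ι → κ) (g : κ → ℝ) (hg : ∀ k, 0 ≤ g k) (R : ℕ)
    (hR : ∀ k, (s.filter (fun x => key x = k)).card ≤ R) :
    ∑ q ∈ s, g (key q) ≤ R * ∑ k ∈ s.image key, g k := by
  rw [Finset.sum_comp, Finset.mul_sum]
  refine Finset.sum_le_sum fun k _ => ?_
  rw [nsmul_eq_mul]
  have : ((s.filter (fun x => key x = k)).card : ℝ) ≤ R := by exact_mod_cast hR k
  exact mul_le_mul_of_nonneg_right this (hg k)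

def ZZ : ℝ := ∑' m : ℤ, (1 + (m:ℝ)^2)⁻¹

lemma ZZ_sum : Summable (fun m : ℤ => (1 + (m:ℝ)^2)⁻¹) := by
  have := (Real.summable_one_div_int_pow (p := 2)).2 (by norm_num)
  refine Summable.of_norm_bounded_eventually (g := fun m : ℤ => 1 / (m:ℝ)^2) this ?_
  rw [Filter.eventually_cofinite]
  refine (Set.finite_singleton (0:ℤ)).subset fun m hm => ?_
  simp only [Set.mem_ofPred_eq] at hm
  by_contra h
  apply hm
  have : (m:ℝ) ≠ 0 := by exact_mod_cast h
  have : 0 < (m:ℝ)^2 := by positivity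
  rw [Real.norm_of_nonneg (by positivity), one_div]
  gcongr; linarith

lemma ZZ_bd (S : Finset ℤ) (k0 : ℤ) : ∑ k ∈ S, (1 + ((k0:ℝ) - k)^2)⁻¹ ≤ ZZ := by
  have h := ((Equiv.subLeft k0).summable_iff (f := fun m : ℤ => (1 + (m:ℝ)^2)⁻¹)).2 ZZ_sum
  have h2 := h.sum_le_tsum S (fun k _ => by simp only [Function.comp]; positivity)
  rw [ZZ, ← (Equiv.subLeft k0).tsum_eq]
  refine le_trans (le_of_eq ?_) h2
  refine Finset.sum_congr rfl fun k _ => ?_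
  simp [Function.comp]

lemma ZZ_nonneg : 0 ≤ ZZ := tsum_nonneg fun m => by positivity

def MultiTile.ctr {n : ℕ} (P : MultiTile n) : ℝ := (2:ℝ)^P.j * P.kt + (2:ℝ)^P.j / 2

lemma row_bd {n : ℕ} {α : Fin n → ℝ} {c : ℝ} (hc : 0 < c) (T s : Finset (MultiTile n)) (hs : s ⊆ T) (PT : MultiTile n)
    (hT : ∀ P ∈ T, ∀ i, Tile.lesim (α i) c (P.tile i) (PT.tile i)) (p : MultiTile n) :
    ∑ q ∈ s, (if (2:ℝ)^q.j = (2:ℝ)^p.j then uu ((2:ℝ)^p.j) (p.ctr - q.ctr) else 0) ≤ RR n c * ZZ := by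
  rw [← Finset.sum_filter]
  have h1 : ∀ q ∈ s.filter (fun q => (2:ℝ)^q.j = (2:ℝ)^p.j), uu ((2:ℝ)^p.j) (p.ctr - q.ctr)
      = (fun k : ℤ => (1 + ((p.kt:ℝ) - k)^2)⁻¹) q.kt := by
    intro q hq
    have hq := (Finset.mem_filter.1 hq).2
    simp only [uu, MultiTile.ctr, hq]
    have p : (0:ℝ) < 2^p.j := by positivity
    congr 3
    field_simp
    ring
  rw [Finset.sum_congr rfl h1]
  refine (fiber_sum _ (fun q : MultiTile n => q.kt) (fun k : ℤ => (1 + ((p.kt:ℝ) - k)^2)⁻¹) (fun k => by positivity) (RR n c) fun k => ?_).trans ?_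
  · refine le_trans (Finset.card_le_card ?_) (count_key hc T PT hT p.j k)
    intro q hq
    simp only [Finset.mem_filter] at hq ⊢
    refine ⟨hs hq.1.1, ?_, hq.2⟩
    exact zpow_right_injective₀ (a := (2:ℝ)) (by norm_num) (by norm_num) hq.1.2
  · gcongr
    exact ZZ_bd _ _

lemma geom_sum (J : Finset ℤ) (jT : ℤ) (hJ : ∀ j ∈ J, j ≤ jT) : ∑ j ∈ J, (2:ℝ)^j ≤ 2 * (2:ℝ)^jT := by
  have h1 : ∑ j ∈ J, (2:ℝ)^j = ∑ j ∈ J, (2:ℝ)^jT * (fun d : ℕ => (1/2:ℝ)^d) (jT - j).toNat := by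
    refine Finset.sum_congr rfl fun j hj => ?_
    have h : ((jT - j).toNat : ℤ) = jT - j := Int.toNat_of_nonneg (by linarith [hJ j hj])
    simp only
    rw [← zpow_natCast, h, one_div, inv_zpow, ← zpow_neg, ← zpow_add₀ (by norm_num)]
    congr 1; ring
  rw [h1, ← Finset.mul_sum, mul_comm]
  gcongr
  rw [← Finset.sum_image (f := fun d : ℕ => (1/2:ℝ)^d) (g := fun j => (jT - j).toNat)]
  · exact (summable_geometric_two.sum_le_tsum _ (fun _ _ => by positivity)).trans (le_of_eq tsum_geometric_two)
  · intro x hx y hy hxy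
    simp only at hxy
    have := hJ x hx
    have := hJ y hy
    omega

lemma count_j {n : ℕ} {α : Fin n → ℝ} {c : ℝ} (hc : 0 < c) (i0 : Fin n) (T : Finset (MultiTile n)) (PT : MultiTile n)
    (hT : ∀ P ∈ T, ∀ i, Tile.lesim (α i) c (P.tile i) (PT.tile i)) (j : ℤ) (hj : j ≤ PT.j) :
    ((T.filter (fun P => P.j = j)).card : ℝ) ≤ RR n c * (2:ℝ)^(PT.j - j) := by
  obtain ⟨d, hd⟩ := Int.eq_ofNat_of_zero_le (sub_nonneg.2 hj)
  have h1 := fiber_sum (T.filter (fun P => P.j = j)) (fun P => P.kt) (fun _ => (1:ℝ)) (fun _ => by norm_num) (RR n c)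
    (fun k => by rw [Finset.filter_filter]; convert count_key hc T PT hT j k)
  simp only [Finset.sum_const, nsmul_eq_mul, mul_one] at h1
  refine h1.trans ?_
  gcongr
  have h2 : ((T.filter (fun P => P.j = j)).image (fun P => P.kt)) ⊆
      Finset.Ico (2^d * PT.kt) (2^d * PT.kt + 2^d) := by
    intro k hk
    simp only [Finset.mem_image, Finset.mem_filter] at hk
    obtain ⟨P, ⟨hP, rfl⟩, rfl⟩ := hk
    obtain ⟨-, g1, g2, -⟩ := lesim_geom (hT P hP i0)
    have e1 : (PT.tile i0).j = PT.j := rfl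
    have e2 : (PT.tile i0).kt = PT.kt := rfl
    have e3 : (P.tile i0).j = P.j := rfl
    have e4 : (P.tile i0).kt = P.kt := rfl
    rw [e1, e2, e3, e4] at g1 g2
    have e5 : (2:ℝ)^PT.j = 2^P.j * 2^d := by
      rw [← zpow_natCast, ← zpow_add₀ (by norm_num)]; congr 1; omega
    rw [e5] at g1 g2
    have p : (0:ℝ) < 2^P.j := by positivity
    have g1' : (2:ℝ)^d * PT.kt ≤ P.kt := le_of_mul_le_mul_left (by linarith) p
    have g2' : (P.kt:ℝ) + 1 ≤ 2^d * PT.kt + 2^d := le_of_mul_le_mul_left (by linarith) p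
    rw [Finset.mem_Ico]
    constructor
    · exact_mod_cast g1'
    · have : P.kt + 1 ≤ 2^d * PT.kt + 2^d := by exact_mod_cast g2'
      omega
  have h3 := Finset.card_le_card h2
  rw [Int.card_Ico] at h3
  have e : (2^d * PT.kt + 2^d - 2^d * PT.kt : ℤ).toNat = 2^d := by
    have : (2^d * PT.kt + 2^d - 2^d * PT.kt : ℤ) = ((2^d : ℕ) : ℤ) := by push_cast; ring
    rw [this, Int.toNat_natCast]
  rw [e] at h3
  rw [hd]
  have : ((Int.ofNat d) : ℤ) = (d:ℤ) := rfl
  try rw [this]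
  rw [zpow_natCast]
  exact_mod_cast h3

lemma sum_four {n : ℕ} {α : Fin n → ℝ} {c : ℝ} (hc : 0 < c) (i0 : Fin n) (T : Finset (MultiTile n)) (PT : MultiTile n)
    (hT : ∀ P ∈ T, ∀ i, Tile.lesim (α i) c (P.tile i) (PT.tile i)) :
    ∑ P ∈ T, ((2:ℝ)^P.j)^2 ≤ 2 * RR n c * ((2:ℝ)^PT.j)^2 := by
  have h := Finset.sum_comp (s := T) (fun j : ℤ => ((2:ℝ)^j)^2) (fun P : MultiTile n => P.j)
  rw [h]
  have hJ : ∀ j ∈ T.image (fun P => P.j), j ≤ PT.j := by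
    intro j hj
    obtain ⟨P, hP, rfl⟩ := Finset.mem_image.1 hj
    exact (lesim_geom (hT P hP i0)).1
  calc _ ≤ ∑ j ∈ T.image (fun P => P.j), (RR n c * (2:ℝ)^PT.j) * (2:ℝ)^j := by
        refine Finset.sum_le_sum fun j hj => ?_
        rw [nsmul_eq_mul]
        have := count_j hc i0 T PT hT j (hJ j hj)
        calc _ ≤ (RR n c * (2:ℝ)^(PT.j - j)) * ((2:ℝ)^j)^2 := by gcongr
          _ = _ := by
            rw [zpow_sub₀ (by norm_num)]
            field_simp
    _ = (RR n c * (2:ℝ)^PT.j) * ∑ j ∈ T.image (fun P => P.j), (2:ℝ)^j := by rw [Finset.mul_sum]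
    _ ≤ (RR n c * (2:ℝ)^PT.j) * (2 * (2:ℝ)^PT.j) := by
        gcongr; exact geom_sum _ _ hJ
    _ = _ := by ring

def KK (c : ℝ) : ℕ := ⌈c + 1⌉₊
lemma KK_pos {c : ℝ} (hc : 0 < c) : 0 < KK c := Nat.ceil_pos.2 (by linarith)
lemma KK_pow (c : ℝ) : c + 1 ≤ 2 ^ KK c := by
  have h1 := Nat.le_ceil (c + 1)
  have h2 : ((KK c : ℕ) : ℝ) ≤ ((2 ^ KK c : ℕ) : ℝ) := by exact_mod_cast (Nat.lt_two_pow_self).le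
  push_cast at h2
  exact h1.trans h2

lemma W_facts {N : ℕ} (hN : 1 ≤ N) (P : Tile) :
    Continuous (fun x => (P.timeIv).chi x ^ (2*N)) ∧ (∀ x, 0 ≤ (P.timeIv).chi x ^ (2*N)) ∧
    ∀ x, (P.timeIv).chi x ^ (2*N) ≤ 4 * uu ((2:ℝ)^P.j) (x - ((2:ℝ)^P.j * P.kt + (2:ℝ)^P.j / 2)) := by
  have hl : 0 < (P.timeIv).len := by show (0:ℝ) < 2^P.j; positivity
  refine ⟨(chi_cont hl).pow _, fun x => pow_nonneg (chi_pos hl x).le _, fun x => chi_pow_le hl hN x⟩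

lemma bump_facts {β : ℝ} {Ca : ℕ → ℝ} {φ : ℝ → ℂ} {P : Tile} (h : AdaptedBump (P.freqIv β) Ca 2 φ) :
    ContDiff ℝ (⊤:ℕ∞) φ ∧
    (∀ ξ, ξ ∉ Set.Ioo (P.freqIv β).l ((P.freqIv β).l + ((2:ℝ)^P.j)⁻¹) → φ ξ = 0) ∧
    (∀ ξ, ‖φ ξ‖ ≤ |Ca 0|) ∧ (∀ ξ, ‖iteratedDeriv 1 φ ξ‖ ≤ |Ca 1| * (2:ℝ)^P.j) ∧
    (∀ ξ, ‖iteratedDeriv 2 φ ξ‖ ≤ |Ca 2| * ((2:ℝ)^P.j)^2) := by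
  obtain ⟨h1, h2, -, h4⟩ := h
  have hl : (P.freqIv β).len = ((2:ℝ)^P.j)⁻¹ := zpow_neg _ _
  have p : (0:ℝ) < 2^P.j := by positivity
  refine ⟨h1, fun ξ hξ => h2 ξ (by unfold Iv.set; rwa [hl]), fun ξ => ?_, fun ξ => ?_, fun ξ => ?_⟩
  · have := h4 0 (by norm_num) ξ
    rw [iteratedDeriv_zero, pow_zero, div_one] at this
    exact this.trans (le_abs_self _)
  · have := h4 1 (by norm_num) ξ
    rw [hl, inv_pow, div_inv_eq_mul, pow_one] at this
    exact this.trans (mul_le_mul_of_nonneg_right (le_abs_self _) p.le)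
  · have := h4 2 (by norm_num) ξ
    rw [hl, inv_pow, div_inv_eq_mul] at this
    exact this.trans (mul_le_mul_of_nonneg_right (le_abs_self _) (by positivity))

lemma bump_KB {β : ℝ} {Ca : ℕ → ℝ} {φ : ℝ → ℂ} {P : Tile} (h : AdaptedBump (P.freqIv β) Ca 2 φ) :
    KB (|Ca 0| + |Ca 2|) ((2:ℝ)^P.j) φ := by
  obtain ⟨h1, h2, h3, -, h5⟩ := bump_facts h
  exact kernel_bd (by positivity) h1 h2 h3 h5

lemma class_bd {n N : ℕ} (hN : 1 ≤ N) {α : Fin n → ℝ} {c : ℝ} (hc : 0 < c) {Ca : ℕ → ℝ}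
    {ψ : Fin n → Tile → ℝ → ℂ} (hψ : ∀ i P, AdaptedBump (Tile.freqIv (α i) P) Ca 2 (ψ i P)) (i : Fin n)
    (T s : Finset (MultiTile n)) (hs : s ⊆ T) (PT : MultiTile n)
    (hT : ∀ P ∈ T, ∀ i, Tile.lesim (α i) c (P.tile i) (PT.tile i))
    (hsep : ∀ P ∈ s, ∀ Q ∈ s, P.j < Q.j → (∀ ξ, ξ ∈ ((P.tile i).freqIv (α i)).set →
      ξ ∉ ((Q.tile i).freqIv (α i)).set))
    {F : ℝ → ℂ} (hF : Integrable F) (hF2 : MemLp F 2) :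
    ∑ P ∈ s, (2:ℝ)^P.j * tileNorm N (ψ i (P.tile i)) (P.tile i) F ^ 2 ≤
      256*π^2*(|Ca 0|^2+(2*|Ca 0| * |Ca 2|+2*|Ca 1|^2))*(RR n c * ZZ)*‖hF2.toLp F‖^2 := by
  have hh : ∀ P : MultiTile n, ∃ h : ℝ → ℂ, Integrable h ∧ (∀ y, ‖h y‖ ≤ 4 * uu ((2:ℝ)^P.j) (y - P.ctr)) ∧
      ∫ x, mulOp (ψ i (P.tile i)) F x * h x =
        ((∫ x, ‖mulOp (ψ i (P.tile i)) F x‖ * ((P.tile i).timeIv).chi x ^ (2*N) : ℝ) : ℂ) := by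
    intro P
    obtain ⟨w1, w2, w3⟩ := W_facts hN (P.tile i)
    exact sign_fn (mulOp_cont (bump_KB (hψ i (P.tile i))).1 hF) (by positivity) w1 w2 w3
  choose h h1 h2 h3 using hh
  have hb := fun P : MultiTile n => bump_facts (hψ i (P.tile i))
  have hlen : ∀ P : MultiTile n, ((P.tile i).freqIv (α i)).set =
      Set.Ioo ((P.tile i).freqIv (α i)).l (((P.tile i).freqIv (α i)).l + ((2:ℝ)^P.j)⁻¹) := by
    intro P
    unfold Iv.set
    have : ((P.tile i).freqIv (α i)).len = ((2:ℝ)^P.j)⁻¹ := zpow_neg _ _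
    rw [this]
  have key := local_sum s (fun P => (2:ℝ)^P.j) (fun P => P.ctr) (fun P => ((P.tile i).freqIv (α i)).l)
    (fun P => ψ i (P.tile i)) h |Ca 0| |Ca 1| |Ca 2| (RR n c * ZZ) (abs_nonneg _) (abs_nonneg _)
    (mul_nonneg (Nat.cast_nonneg _) ZZ_nonneg) (fun P => by positivity) (fun P => (hb P).1)
    (fun P => (hb P).2.1) (fun P => (hb P).2.2.1) (fun P => (hb P).2.2.2.1) (fun P => (hb P).2.2.2.2)
    h1 h2 (by
      intro P hP Q hQ hne ξ hξ hξ'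
      rw [← hlen] at hξ hξ'
      rcases lt_trichotomy P.j Q.j with hj | hj | hj
      · exact hsep P hP Q hQ hj ξ hξ hξ'
      · exact hne (by simp only [hj])
      · exact hsep Q hQ P hP hj ξ hξ' hξ)
    (fun P _ => row_bd hc T s hs PT hT P) F hF hF2
  refine le_trans (le_of_eq ?_) key
  refine Finset.sum_congr rfl fun P _ => ?_
  simp only [h3]
  rw [Complex.norm_real, Real.norm_eq_abs, sq_abs, tileNorm]
  have e : (P.tile i).j = P.j := rfl
  rw [e]
  have p : (0:ℝ) < 2^P.j := by positivity
  field_simp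

lemma F1_bd {n N : ℕ} (hN : 1 ≤ N) {α : Fin n → ℝ} {c : ℝ} (hc : 0 < c) {Ca : ℕ → ℝ}
    {ψ : Fin n → Tile → ℝ → ℂ} (hψ : ∀ i P, AdaptedBump (Tile.freqIv (α i) P) Ca 2 (ψ i P)) (i : Fin n)
    (T : Finset (MultiTile n)) (PT : MultiTile n)
    (hT : ∀ P ∈ T, ∀ i, Tile.lesim (α i) c (P.tile i) (PT.tile i))
    {F : ℝ → ℂ} (hF : Integrable F) (hF2 : MemLp F 2) :
    ∑ P ∈ T.filter (fun P => Tile.lesim' (α i) c (P.tile i) (PT.tile i)),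
      (2:ℝ)^P.j * tileNorm N (ψ i (P.tile i)) (P.tile i) F ^ 2 ≤
      (KK c + 1) * (256*π^2*(|Ca 0|^2+(2*|Ca 0| * |Ca 2|+2*|Ca 1|^2))*(RR n c * ZZ)*‖hF2.toLp F‖^2) := by
  set key : MultiTile n → ℕ := fun P => if P.j = PT.j then KK c else (P.j % (KK c : ℤ)).toNat with hkey
  have hK : (0:ℤ) < KK c := by exact_mod_cast KK_pos hc
  have hmaps : ∀ P ∈ T.filter (fun P => Tile.lesim' (α i) c (P.tile i) (PT.tile i)),
      key P ∈ Finset.range (KK c + 1) := by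
    intro P _
    simp only [hkey, Finset.mem_range]
    split_ifs
    · omega
    · have := Int.emod_lt_of_pos P.j hK
      omega
  rw [← Finset.sum_fiberwise_of_maps_to hmaps]
  refine (Finset.sum_le_card_nsmul _ _ _ fun r hr => class_bd hN hc hψ i T _
    ((Finset.filter_subset _ _).trans (Finset.filter_subset _ _)) PT hT ?_ hF hF2).trans ?_
  · intro P hP Q hQ hj ξ hξ hξ'
    simp only [Finset.mem_filter] at hP hQ
    obtain ⟨⟨hPT, hP⟩, hPr⟩ := hP
    obtain ⟨⟨hQT, hQ⟩, hQr⟩ := hQ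
    have hQj : Q.j ≤ PT.j := (lesim_geom (hT Q hQT i)).1
    have hPj : P.j < PT.j := by omega
    have e0 : 0 ≤ P.j % (KK c : ℤ) := Int.emod_nonneg _ hK.ne'
    have e1 : 0 ≤ Q.j % (KK c : ℤ) := Int.emod_nonneg _ hK.ne'
    have e2 := Int.emod_lt_of_pos P.j hK
    have e3 : key P = (P.j % (KK c : ℤ)).toNat := by simp only [hkey]; rw [if_neg hPj.ne]
    have hQj' : Q.j < PT.j := by
      rcases hQj.lt_or_eq with h | h
      · exact h
      · exfalso
        have : key Q = KK c := by simp only [hkey]; rw [if_pos h]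
        omega
    have e4 : key Q = (Q.j % (KK c : ℤ)).toNat := by simp only [hkey]; rw [if_neg hQj'.ne]
    have e5 : P.j % (KK c : ℤ) = Q.j % (KK c : ℤ) := by omega
    have e6 : (KK c : ℤ) ∣ Q.j - P.j := Int.ModEq.dvd e5
    have e7 : (KK c : ℤ) ≤ Q.j - P.j := Int.le_of_dvd (by omega) e6
    have g1 := (lesim'_geom hP hPj hξ).1
    have g2 := (lesim'_geom hQ hQj' hξ').2
    have e8 : (c + 1) * (2:ℝ)^(-Q.j) ≤ 2^(-P.j) := by
      calc _ ≤ (2:ℝ)^(KK c) * (2:ℝ)^(-Q.j) := by gcongr; exact KK_pow c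
        _ = (2:ℝ)^((KK c : ℤ) + -Q.j) := by rw [zpow_add₀ (by norm_num), zpow_natCast]
        _ ≤ _ := zpow_le_zpow_right₀ (by norm_num) (by omega)
    have e9 : (P.tile i).j = P.j := rfl
    have e10 : (Q.tile i).j = Q.j := rfl
    rw [e9] at g1; rw [e10] at g2
    have : (0:ℝ) < 2^(-P.j) := by positivity
    linarith
  · rw [Finset.card_range, nsmul_eq_mul]; push_cast; exact le_rfl

lemma F2_bd {n N : ℕ} (hN : 1 ≤ N) {α : Fin n → ℝ} {c : ℝ} (hc : 0 < c) {Ca : ℕ → ℝ}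
    {ψ : Fin n → Tile → ℝ → ℂ} (hψ : ∀ i P, AdaptedBump (Tile.freqIv (α i) P) Ca 2 (ψ i P)) (i : Fin n)
    (T : Finset (MultiTile n)) (PT : MultiTile n)
    (hT : ∀ P ∈ T, ∀ i, Tile.lesim (α i) c (P.tile i) (PT.tile i))
    {F : ℝ → ℂ} (hF : Integrable F) {A : ℝ} (hA0 : 0 ≤ A) (hA : ∀ᵐ y, ‖F y‖ ≤ A)
    (hout : ∀ y, |y - PT.ctr| < 3/2 * (2:ℝ)^PT.j → F y = 0) :
    ∑ P ∈ T, (2:ℝ)^P.j * tileNorm N (ψ i (P.tile i)) (P.tile i) F ^ 2 ≤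
      64 * (|Ca 0| + |Ca 2|)^2 * VV^4 * RR n c * A^2 * (2:ℝ)^PT.j := by
  have p : (0:ℝ) < 2^PT.j := by positivity
  calc _ ≤ ∑ P ∈ T, 32 * (|Ca 0| + |Ca 2|)^2 * VV^4 * A^2 / (2:ℝ)^PT.j * ((2:ℝ)^P.j)^2 := by
        refine Finset.sum_le_sum fun P hP => ?_
        obtain ⟨w1, w2, w3⟩ := W_facts hN (P.tile i)
        have q : (0:ℝ) < 2^P.j := by positivity
        have := tail_bd (L := (2:ℝ)^P.j) (M := (2:ℝ)^PT.j) (by positivity) p (bump_KB (hψ i (P.tile i))) hF hA0 hA ?_ w1 w2 w3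
        · calc _ ≤ (2:ℝ)^P.j * (32 * (|Ca 0| + |Ca 2|)^2 * VV^4 * A^2 * ((2:ℝ)^P.j / (2:ℝ)^PT.j)) :=
                mul_le_mul_of_nonneg_left this q.le
            _ = _ := by field_simp
        · intro y hy
          apply hout
          obtain ⟨-, g1, g2, -⟩ := lesim_geom (hT P hP i)
          have e1 : (PT.tile i).j = PT.j := rfl
          have e2 : (PT.tile i).kt = PT.kt := rfl
          have e3 : (P.tile i).j = P.j := rfl
          have e4 : (P.tile i).kt = P.kt := rfl
          rw [e1, e2, e3, e4] at g1 g2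
          rw [e3, e4] at hy
          unfold MultiTile.ctr
          rw [abs_lt] at hy ⊢
          constructor <;> linarith [hy.1, hy.2]
    _ = 32 * (|Ca 0| + |Ca 2|)^2 * VV^4 * A^2 / (2:ℝ)^PT.j * ∑ P ∈ T, ((2:ℝ)^P.j)^2 := by rw [Finset.mul_sum]
    _ ≤ 32 * (|Ca 0| + |Ca 2|)^2 * VV^4 * A^2 / (2:ℝ)^PT.j * (2 * RR n c * ((2:ℝ)^PT.j)^2) := by
        have := VV_nonneg
        gcongr
        exact sum_four hc i T PT hT
    _ = _ := by field_simp; ring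

lemma L2_bd {F : ℝ → ℂ} (hF : Integrable F) {A x r : ℝ} (hA0 : 0 ≤ A) (hr : 0 < r) (hA : ∀ᵐ y, ‖F y‖ ≤ A)
    (hout : ∀ y, y ∉ Metric.ball x r → F y = 0) :
    ∃ h : MemLp F 2, ‖h.toLp F‖^2 ≤ A^2 * (2 * r) := by
  have h1 : eLpNorm F 2 volume ≤ ENNReal.ofReal (A * √(2 * r)) := by
    have h2 : eLpNorm F 2 volume ≤ eLpNorm ((Metric.ball x r).indicator (fun _ => A)) 2 volume := by
      refine eLpNorm_mono_ae ?_
      filter_upwards [hA] with y hy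
      by_cases hm : y ∈ Metric.ball x r
      · rw [Set.indicator_of_mem hm, Real.norm_of_nonneg hA0]; exact hy
      · rw [hout y hm]; simp
    refine h2.trans (le_of_eq ?_)
    rw [eLpNorm_indicator_const Metric.isOpen_ball.measurableSet (by norm_num) (by norm_num), Real.volume_ball,
      Real.enorm_of_nonneg hA0, ENNReal.ofReal_mul hA0, Real.sqrt_eq_rpow, ENNReal.ofReal_rpow_of_nonneg (by positivity) (by positivity)]
    norm_num
  have hm : MemLp F 2 := ⟨hF.aestronglyMeasurable, h1.trans_lt ENNReal.ofReal_lt_top⟩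
  refine ⟨hm, ?_⟩
  rw [Lp.norm_toLp]
  have h3 := ENNReal.toReal_mono ENNReal.ofReal_ne_top h1
  rw [ENNReal.toReal_ofReal (by positivity)] at h3
  calc _ ≤ (A * √(2*r))^2 := by gcongr
    _ = _ := by rw [mul_pow, Real.sq_sqrt (by positivity)]

lemma tileNorm_nonneg (N : ℕ) (ψ : ℝ → ℂ) (P : Tile) (f : ℝ → ℂ) : 0 ≤ tileNorm N ψ P f := by
  unfold tileNorm
  have hl : 0 < (P.timeIv).len := by show (0:ℝ) < 2^P.j; positivity
  exact mul_nonneg (by positivity) (integral_nonneg fun x => mul_nonneg (norm_nonneg _) (pow_nonneg (chi_pos hl x).le _))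

lemma tileNorm_add {N : ℕ} (hN : 1 ≤ N) {D : ℝ} {φ F G : ℝ → ℂ} {P : Tile} (hφ : KB D ((2:ℝ)^P.j) φ)
    (hF : Integrable F) (hG : Integrable G) {A : ℝ} (hA : ∀ᵐ y, ‖F y‖ ≤ A) (hB : ∀ᵐ y, ‖G y‖ ≤ A) :
    tileNorm N φ P (fun y => F y + G y) ≤ tileNorm N φ P F + tileNorm N φ P G := by
  obtain ⟨w1, w2, w3⟩ := W_facts hN P
  have p : (0:ℝ) < 2^P.j := by positivity
  have i1 := mulOp_W_int p hφ hF hA w1 w2 w3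
  have i2 := mulOp_W_int p hφ hG hB w1 w2 w3
  unfold tileNorm
  rw [← mul_add, ← integral_add i1 i2]
  refine mul_le_mul_of_nonneg_left ?_ (by positivity)
  refine integral_mono_of_nonneg (Filter.Eventually.of_forall fun x => mul_nonneg (norm_nonneg _) (w2 x)) (i1.add i2)
    (Filter.Eventually.of_forall fun x => ?_)
  simp only [mulOp_add hφ.1 hF hG, ← add_mul]
  exact mul_le_mul_of_nonneg_right (norm_add_le _ _) (w2 x)

def C1 (n : ℕ) (c : ℝ) (Ca : ℕ → ℝ) : ℝ :=
  2 * ((KK c + 1) * (256*π^2*(|Ca 0|^2+(2*|Ca 0| * |Ca 2|+2*|Ca 1|^2))*(RR n c * ZZ)*3))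
   + 2 * (64 * (|Ca 0| + |Ca 2|)^2 * VV^4 * RR n c)

lemma C1_nonneg (n : ℕ) (c : ℝ) (Ca : ℕ → ℝ) : 0 ≤ C1 n c Ca := by
  unfold C1
  have := VV_nonneg
  have := ZZ_nonneg
  positivity

lemma sq_sum_bd {n N : ℕ} (hN : 1 ≤ N) {α : Fin n → ℝ} {c : ℝ} (hc : 0 < c) {Ca : ℕ → ℝ}
    {ψ : Fin n → Tile → ℝ → ℂ} (hψ : ∀ i P, AdaptedBump (Tile.freqIv (α i) P) Ca 2 (ψ i P)) (i : Fin n)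
    (T : Finset (MultiTile n)) (PT : MultiTile n)
    (hT : ∀ P ∈ T, ∀ i, Tile.lesim (α i) c (P.tile i) (PT.tile i))
    {f : ℝ → ℂ} (hf : Integrable f) {A : ℝ} (hA0 : 0 ≤ A) (hA : ∀ᵐ y, ‖f y‖ ≤ A) :
    ∑ P ∈ T.filter (fun P => Tile.lesim' (α i) c (P.tile i) (PT.tile i)),
      (2:ℝ)^P.j * tileNorm N (ψ i (P.tile i)) (P.tile i) f ^ 2 ≤ C1 n c Ca * A^2 * (2:ℝ)^PT.j := by
  have p : (0:ℝ) < 2^PT.j := by positivity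
  set S := Metric.ball PT.ctr (3/2 * (2:ℝ)^PT.j) with hS
  have hSm : MeasurableSet S := Metric.isOpen_ball.measurableSet
  set F := S.indicator f with hFd
  set G := Sᶜ.indicator f with hGd
  have hF : Integrable F := hf.indicator hSm
  have hG : Integrable G := hf.indicator hSm.compl
  have hFA : ∀ᵐ y, ‖F y‖ ≤ A := hA.mono fun y hy => (norm_indicator_le_norm_self _ _).trans hy
  have hGA : ∀ᵐ y, ‖G y‖ ≤ A := hA.mono fun y hy => (norm_indicator_le_norm_self _ _).trans hy
  have hfe : f = fun y => F y + G y := (Set.indicator_self_add_compl S f).symm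
  obtain ⟨hF2, hF2n⟩ := L2_bd hF hA0 (x := PT.ctr) (r := 3/2 * (2:ℝ)^PT.j) (by positivity) hFA
    (fun y hy => Set.indicator_of_notMem hy _)
  have b1 := F1_bd hN hc hψ i T PT hT hF hF2
  have b2 := F2_bd hN hc hψ i T PT hT hG hA0 hGA (by
    intro y hy
    refine Set.indicator_of_notMem ?_ _
    simp only [Set.mem_compl_iff, not_not, hS, Metric.mem_ball, Real.dist_eq]
    exact hy)
  have b3 : ∑ P ∈ T.filter (fun P => Tile.lesim' (α i) c (P.tile i) (PT.tile i)),
      (2:ℝ)^P.j * tileNorm N (ψ i (P.tile i)) (P.tile i) G ^ 2 ≤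
      ∑ P ∈ T, (2:ℝ)^P.j * tileNorm N (ψ i (P.tile i)) (P.tile i) G ^ 2 :=
    Finset.sum_le_sum_of_subset_of_nonneg (Finset.filter_subset _ _) fun _ _ _ => by positivity
  have hZ := ZZ_nonneg
  have b4 : (KK c + 1) * (256*π^2*(|Ca 0|^2+(2*|Ca 0| * |Ca 2|+2*|Ca 1|^2))*(RR n c * ZZ)*‖hF2.toLp F‖^2)
     ≤ (KK c + 1) * (256*π^2*(|Ca 0|^2+(2*|Ca 0| * |Ca 2|+2*|Ca 1|^2))*(RR n c * ZZ)*(A^2 * (2 * (3/2 * (2:ℝ)^PT.j)))) := by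
    gcongr
  calc _ ≤ ∑ P ∈ T.filter (fun P => Tile.lesim' (α i) c (P.tile i) (PT.tile i)),
        (2 * ((2:ℝ)^P.j * tileNorm N (ψ i (P.tile i)) (P.tile i) F ^ 2) +
         2 * ((2:ℝ)^P.j * tileNorm N (ψ i (P.tile i)) (P.tile i) G ^ 2)) := by
        refine Finset.sum_le_sum fun P _ => ?_
        have h1 := tileNorm_add hN (bump_KB (hψ i (P.tile i))) hF hG hFA hGA
        rw [← hfe] at h1
        have h0 := tileNorm_nonneg N (ψ i (P.tile i)) (P.tile i) f
        have q : (0:ℝ) < 2^P.j := by positivity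
        have h2 : tileNorm N (ψ i (P.tile i)) (P.tile i) f ^ 2 ≤
          2 * tileNorm N (ψ i (P.tile i)) (P.tile i) F ^ 2 + 2 * tileNorm N (ψ i (P.tile i)) (P.tile i) G ^ 2 := by
          refine (pow_le_pow_left₀ h0 h1 2).trans ?_
          nlinarith [sq_nonneg (tileNorm N (ψ i (P.tile i)) (P.tile i) F - tileNorm N (ψ i (P.tile i)) (P.tile i) G)]
        calc _ ≤ _ := mul_le_mul_of_nonneg_left h2 q.le
          _ = _ := by ring
    _ = 2 * (∑ P ∈ T.filter (fun P => Tile.lesim' (α i) c (P.tile i) (PT.tile i)), ((2:ℝ)^P.j * tileNorm N (ψ i (P.tile i)) (P.tile i) F ^ 2)) +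
        2 * (∑ P ∈ T.filter (fun P => Tile.lesim' (α i) c (P.tile i) (PT.tile i)), ((2:ℝ)^P.j * tileNorm N (ψ i (P.tile i)) (P.tile i) G ^ 2)) := by
        rw [Finset.sum_add_distrib, Finset.mul_sum, Finset.mul_sum]
    _ ≤ 2 * ((KK c + 1) * (256*π^2*(|Ca 0|^2+(2*|Ca 0| * |Ca 2|+2*|Ca 1|^2))*(RR n c * ZZ)*(A^2 * (2 * (3/2 * (2:ℝ)^PT.j)))))
        + 2 * (64 * (|Ca 0| + |Ca 2|)^2 * VV^4 * RR n c * A^2 * (2:ℝ)^PT.j) := by linarith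
    _ = _ := by unfold C1; ring

lemma tileNorm_zero {N : ℕ} {ψ f : ℝ → ℂ} {P : Tile} (h : ∀ ξ, 𝓕 f ξ = 0) : tileNorm N ψ P f = 0 := by
  simp [tileNorm, mulOp, h]

lemma fourier_zero_of_not {f : ℝ → ℂ} (h : ¬ Integrable f) (ξ : ℝ) : 𝓕 f ξ = 0 := by
  rw [Real.fourier_eq]
  apply integral_undef
  rw [Real.fourierIntegral_convergent_iff]
  exact h

lemma tree_all {n : ℕ} {α : Fin n → ℝ} {c cs : ℝ} {Ps T : Finset (MultiTile n)} {PT : MultiTile n} {jdx : Fin n}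
    (hr : HasRank n 1 α c cs Ps) (h : IsTree n α Ps T PT jdx) :
    ∀ P ∈ T, ∀ i, Tile.lesim (α i) c (P.tile i) (PT.tile i) := by
  intro P hP
  exact (hr PT h.1 P (h.2.1 hP) (fun _ => jdx) (Subsingleton.strictMono _) (fun _ => h.2.2 P hP)).1

/-- Lemma 7.8 (`lambda-lemma`): the size of any tree is bounded by `aᵢ λᵢ` when
the localized L¹ averages of `fᵢ` are controlled on every interval. -/
theorem statement18 (n : ℕ) (hn : 2 ≤ n) (N : ℕ)
    (α : Fin n → ℝ) (hα : ∀ i, α i = 0 ∨ α i = 1/3 ∨ α i = 2/3)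
    (Ca : ℕ → ℝ) (c₃ csmall : ℝ) (hc₃ : 0 < c₃) (hcs : 0 < csmall) :
    ∃ (M : ℕ) (C : ℝ),
      ∀ ψ : Fin n → Tile → ℝ → ℂ,
        (∀ i P, AdaptedBump (Tile.freqIv (α i) P) Ca M (ψ i P)) →
        ∀ (f : ℝ → ℂ) (i : Fin n) (a lamI : ℝ),
          0 < a → 0 < lamI →
          (∀ I : Iv, 0 < I.len → (∫ x, ‖f x‖ * I.chi x ^ N) ≤ a * lamI * I.len) →
          ∀ Ps : Finset (MultiTile n), HasRank n 1 α c₃ csmall Ps →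
          ∀ (T : Finset (MultiTile n)) (PT : MultiTile n) (jdx : Fin n),
            IsTree n α Ps T PT jdx →
            treeSize n N α c₃ ψ i f T PT ≤ C * a * lamI := by
  refine ⟨2, √(C1 n c₃ Ca) + 4 * (|Ca 0| + |Ca 2|) * π ^ 2, ?_⟩
  intro ψ hψ f i a lamI ha hl hyp Ps hrank T PT jdx htree
  have hC0 : 0 ≤ √(C1 n c₃ Ca) + 4 * (|Ca 0| + |Ca 2|) * π ^ 2 := by positivity
  have hA0 : 0 < a * lamI := by positivity
  have hzero : (∀ ξ, 𝓕 f ξ = 0) → treeSize n N α c₃ ψ i f T PT ≤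
      (√(C1 n c₃ Ca) + 4 * (|Ca 0| + |Ca 2|) * π ^ 2) * a * lamI := by
    intro h
    have : treeSize n N α c₃ ψ i f T PT = 0 := by
      simp [treeSize, treeNorm, tileNorm_zero h]
    rw [this]
    positivity
  by_cases hf : Integrable f
  swap
  · exact hzero (fourier_zero_of_not hf)
  rcases Nat.eq_zero_or_pos N with hN | hN
  · apply hzero
    have h1 : ∫ x, ‖f x‖ ≤ 0 := by
      refine le_of_forall_pos_le_add fun ε hε => ?_
      have := hyp ⟨0, ε / (a * lamI)⟩ (by simp only; positivity)
      simp only [hN, pow_zero, mul_one] at this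
      rw [mul_div_cancel₀ _ hA0.ne'] at this
      linarith
    have h2 : ∫ x, ‖f x‖ = 0 := le_antisymm h1 (integral_nonneg fun _ => norm_nonneg _)
    rw [integral_eq_zero_iff_of_nonneg (fun _ => norm_nonneg _) hf.norm] at h2
    intro ξ
    rw [Real.fourier_eq]
    apply integral_eq_zero_of_ae
    filter_upwards [h2] with x hx
    have : f x = 0 := norm_eq_zero.1 hx
    simp [this]
  have hA := ae_bd hf hyp
  have hT := tree_all hrank htree
  have p : (0:ℝ) < 2^PT.j := by positivity
  have h1 := sq_sum_bd (N := N) hN hc₃ hψ i T PT hT hf hA0.le hA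
  unfold treeSize
  rw [← Finset.sum_filter]
  have h2 : √(((2:ℝ)^PT.j)⁻¹ * ∑ P ∈ T.filter (fun P => Tile.lesim' (α i) c₃ (P.tile i) (PT.tile i)),
      (2:ℝ)^P.j * tileNorm N (ψ i (P.tile i)) (P.tile i) f ^ 2) ≤ √(C1 n c₃ Ca) * (a * lamI) := by
    rw [← Real.sqrt_sq hA0.le, ← Real.sqrt_mul (C1_nonneg _ _ _)]
    apply Real.sqrt_le_sqrt
    rw [inv_mul_le_iff₀ p]
    linarith
  have h3 : treeNorm n N ψ i f T ≤ 4 * (|Ca 0| + |Ca 2|) * π ^ 2 * (a * lamI) := by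
    unfold treeNorm
    refine Real.iSup_le (fun P => Real.iSup_le (fun _ => ?_) (by positivity)) (by positivity)
    obtain ⟨w1, w2, w3⟩ := W_facts hN (P.tile i)
    exact sup_bd (by positivity) (bump_KB (hψ i (P.tile i))) hf hA0.le hA w1 w2 w3
  calc _ ≤ _ := add_le_add h2 h3
    _ = _ := by ring
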